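/- For every α > 0 there exist β > 0 and C > 0 such that for every ε > 0 there are infinitely many positive integers k with the following property: for every N there exists a k-regular finite simple graph G on n ≥ N vertices such that, with probability at least 1 − ε, every induced subgraph H of the random subgraph G_{1/2} with minimum degree at least k/4 + α·k satisfies |V(H)| ≤ C·(1 − β)^{k²}·n. -/

import Mathlib

open scoped Classical

/-- Probability, for the random subgraph of `G` in which each edge of `G` is retained
independently with probability `p`, of the event `A`. -/
noncomputable def subgraphProb {V : Type} [Fintype V] (G : SimpleGraph V)
    (p : ℝ) (A : SimpleGraph V → Prop) : ℝ :=
  ∑ s ∈ G.edgeSet.toFinset.powerset,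
    (if A (SimpleGraph.fromEdgeSet ↑s) then
      p ^ s.card * (1 - p) ^ (G.edgeSet.toFinset.card - s.card) else 0)


/-- Probability of the event `A` for a uniformly random subset of the finite set `E`. -/
noncomputable def unifProb {ι : Type*} (E : Finset ι) (A : Finset ι → Prop) : ℝ :=
  ((E.powerset.filter A).card : ℝ) / 2 ^ E.card

/-- The event `A` is determined by the trace of the random set on `X`. -/
def DetBy {ι : Type*} (A : Finset ι → Prop) (X : Set ι) : Prop :=
  ∀ s t : Finset ι, (∀ e ∈ X, e ∈ s ↔ e ∈ t) → (A s ↔ A t)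

namespace unifProb

variable {ι : Type*} {E : Finset ι} {A B : Finset ι → Prop}

lemma eq_div (E : Finset ι) (A : Finset ι → Prop) [DecidablePred A] :
    unifProb E A = ((E.powerset.filter A).card : ℝ) / 2 ^ E.card := by
  unfold unifProb
  congr!

lemma nonneg : 0 ≤ unifProb E A := by unfold unifProb; positivity

lemma mono (h : ∀ s ⊆ E, A s → B s) : unifProb E A ≤ unifProb E B := by
  unfold unifProb
  gcongr ?_ / _
  refine Nat.cast_le.2 (Finset.card_le_card fun s hs => ?_)
  simp only [Finset.mem_filter, Finset.mem_powerset] at hs ⊢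
  exact ⟨hs.1, h s hs.1 hs.2⟩

lemma congr (h : ∀ s ⊆ E, A s ↔ B s) : unifProb E A = unifProb E B :=
  le_antisymm (mono fun s hs => (h s hs).1) (mono fun s hs => (h s hs).2)

lemma add_compl : unifProb E A + unifProb E (fun s => ¬ A s) = 1 := by
  unfold unifProb
  rw [← add_div, ← Nat.cast_add, Finset.card_filter_add_card_filter_not, Finset.card_powerset]
  simp

lemma le_one : unifProb E A ≤ 1 := by
  linarith [add_compl (E := E) (A := A), nonneg (E := E) (A := fun s => ¬ A s)]

lemma or_le : unifProb E (fun s => A s ∨ B s) ≤ unifProb E A + unifProb E B := by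
  simp only [eq_div]
  rw [← add_div, Finset.filter_or]
  gcongr ?_ / _
  exact_mod_cast Finset.card_union_le _ _

lemma exists_le {κ : Type*} (I : Finset κ) (A : κ → Finset ι → Prop) :
    unifProb E (fun s => ∃ i ∈ I, A i s) ≤ ∑ i ∈ I, unifProb E (A i) := by
  induction I using Finset.induction_on with
  | empty => simp [unifProb]
  | insert i I hi ih =>
    rw [Finset.sum_insert hi]
    refine le_trans (mono fun s _ h => ?_) (or_le.trans (add_le_add_right ih _))
    simpa using h

lemma exists_le_card_mul {κ : Type*} (I : Finset κ) (A : κ → Finset ι → Prop) (x : ℝ)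
    (h : ∀ i ∈ I, unifProb E (A i) ≤ x) :
    unifProb E (fun s => ∃ i ∈ I, A i s) ≤ I.card * x := by
  refine (exists_le I A).trans ((Finset.sum_le_sum h).trans ?_)
  simp

lemma card_filter_and {X : Set ι} (hA : DetBy A X) (hB : DetBy B Xᶜ) :
    (E.powerset.filter (fun s => A s ∧ B s)).card =
      ((E.filter (· ∈ X)).powerset.filter A).card *
        ((E.filter (· ∉ X)).powerset.filter B).card := by
  rw [← Finset.card_product]
  refine Finset.card_nbij' (fun s => (s.filter (· ∈ X), s.filter (· ∉ X)))
    (fun p => p.1 ∪ p.2) ?_ ?_ ?_ ?_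
  · intro s hs
    simp only [Finset.coe_filter, Finset.mem_powerset, Set.mem_ofPred_eq, Finset.coe_product,
      Set.mem_prod] at hs ⊢
    refine ⟨⟨Finset.filter_subset_filter _ hs.1, (hA _ _ ?_).1 hs.2.1⟩,
      Finset.filter_subset_filter _ hs.1, (hB _ _ ?_).1 hs.2.2⟩ <;> intro e he <;> simp_all
  · rintro ⟨a, b⟩ h
    simp only [Finset.coe_filter, Finset.mem_powerset, Set.mem_ofPred_eq, Finset.coe_product,
      Set.mem_prod, Finset.subset_iff, Finset.mem_filter] at h ⊢
    obtain ⟨⟨h1, h2⟩, h3, h4⟩ := h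
    refine ⟨fun e he => ?_, (hA _ _ ?_).1 h2, (hB _ _ ?_).1 h4⟩
    · rcases Finset.mem_union.1 he with h | h
      exacts [(h1 h).1, (h3 h).1]
    · intro e he
      have := fun h => (h3 (x := e) h).2 he
      simpa using fun h => (this h).elim
    · intro e he
      have := fun h => he (h1 (x := e) h).2
      simpa using fun h => (this h).elim
  · intro s _
    exact Finset.filter_union_filter_not_eq _ s
  · rintro ⟨a, b⟩ h
    simp only [Finset.coe_filter, Finset.mem_powerset, Set.mem_ofPred_eq, Finset.coe_product,
      Set.mem_prod, Finset.subset_iff, Finset.mem_filter] at h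
    obtain ⟨⟨h1, -⟩, h3, -⟩ := h
    ext e
    · simp only [Finset.mem_filter, Finset.mem_union]
      have := fun h => (h1 (x := e) h).2
      have := fun h => (h3 (x := e) h).2
      tauto
    · simp only [Finset.mem_filter, Finset.mem_union]
      have := fun h => (h1 (x := e) h).2
      have := fun h => (h3 (x := e) h).2
      tauto

lemma and_eq_mul {X : Set ι} (hA : DetBy A X) (hB : DetBy B Xᶜ) :
    unifProb E (fun s => A s ∧ B s) = unifProb E A * unifProb E B := by
  have hT : ∀ Y : Set ι, DetBy (fun _ : Finset ι => True) Y := fun _ _ _ _ => Iff.rfl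
  have h1 := card_filter_and (E := E) hA (hT Xᶜ)
  have h2 := card_filter_and (E := E) (hT X) hB
  have h3 := card_filter_and (E := E) hA hB
  have h4 := Finset.card_filter_add_card_filter_not (s := E) (· ∈ X)
  simp only [and_true, true_and, Finset.filter_true, Finset.card_powerset] at h1 h2
  simp only [eq_div]
  rw [h1, h2, h3, ← h4]
  push_cast
  rw [pow_add]
  field_simp

end unifProb

namespace DetBy

variable {ι : Type*} {A B : Finset ι → Prop} {X Y : Set ι}

lemma mono (hA : DetBy A X) (h : X ⊆ Y) : DetBy A Y :=
  fun s t hst => hA s t fun e he => hst e (h he)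

lemma not (hA : DetBy A X) : DetBy (fun s => ¬ A s) X :=
  fun s t hst => not_congr (hA s t hst)

lemma and (hA : DetBy A X) (hB : DetBy B X) : DetBy (fun s => A s ∧ B s) X :=
  fun s t hst => and_congr (hA s t hst) (hB s t hst)

lemma all {κ : Sort*} {A : κ → Finset ι → Prop} (hA : ∀ i, DetBy (A i) X) :
    DetBy (fun s => ∀ i, A i s) X :=
  fun s t hst => forall_congr' fun i => hA i s t hst

end DetBy

namespace unifProb

variable {ι : Type*} {E : Finset ι}

lemma forall_le_pow {κ : Type*} (I : Finset κ) (A : κ → Finset ι → Prop) (X : κ → Set ι)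
    (hA : ∀ i ∈ I, DetBy (A i) (X i))
    (hX : ∀ i ∈ I, ∀ j ∈ I, i ≠ j → Disjoint (X i) (X j)) (x : ℝ)
    (h : ∀ i ∈ I, unifProb E (A i) ≤ x) :
    unifProb E (fun s => ∀ i ∈ I, A i s) ≤ x ^ I.card := by
  induction I using Finset.induction_on with
  | empty => simpa using le_one
  | insert i I hi ih =>
    have hrest : DetBy (fun s => ∀ j ∈ I, A j s) (X i)ᶜ := by
      refine DetBy.all fun j => DetBy.all fun hj => (hA j (by simp [hj])).mono ?_
      rw [Set.subset_compl_iff_disjoint_left]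
      exact hX i (by simp) j (by simp [hj]) (by rintro rfl; exact hi hj)
    have key := and_eq_mul (E := E) (hA i (by simp)) hrest
    rw [Finset.card_insert_of_notMem hi, pow_succ', congr (B := fun s => A i s ∧ ∀ j ∈ I, A j s)
      (by simp), key]
    have hx := h i (by simp)
    refine mul_le_mul hx (ih (fun j hj => hA j (by simp [hj]))
      (fun a ha b hb => hX a (by simp [ha]) b (by simp [hb]))
      (fun j hj => h j (by simp [hj]))) nonneg (nonneg.trans hx)

lemma avoid_eq (X : Set ι) :
    unifProb E (fun s => ∀ e ∈ s, e ∉ X) = (1 / 2) ^ (E.filter (· ∈ X)).card := by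
  have h4 := Finset.card_filter_add_card_filter_not (s := E) (· ∈ X)
  have : E.powerset.filter (fun s => ∀ e ∈ s, e ∉ X) = (E.filter (· ∉ X)).powerset := by
    ext s
    simp only [Finset.mem_filter, Finset.mem_powerset, Finset.subset_iff]
    exact ⟨fun h e he => ⟨h.1 he, h.2 e he⟩, fun h => ⟨fun e he => (h he).1, fun e he => (h he).2⟩⟩
  simp only [eq_div]
  rw [this, Finset.card_powerset, ← h4, pow_add]
  push_cast
  rw [one_div, inv_pow]
  field_simp

lemma chernoff [DecidableEq ι] (F : Finset ι) (hF : F ⊆ E) (x l : ℝ) (hl : 0 ≤ l) :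
    unifProb E (fun s => x ≤ ((s ∩ F).card : ℝ)) ≤
      Real.exp (l ^ 2 * F.card / 8 + l * F.card / 2 - l * x) := by
  have hcard : ∀ s ∈ E.powerset, ∏ e ∈ s, (if e ∈ F then Real.exp l else 1) =
      Real.exp (l * (s ∩ F).card) := by
    intro s _
    rw [Finset.prod_ite_mem, Finset.prod_const, mul_comm, Real.exp_nat_mul]
  have h1 : ((E.powerset.filter (fun s => x ≤ ((s ∩ F).card : ℝ))).card : ℝ) ≤
      ∑ s ∈ E.powerset, (∏ e ∈ s, if e ∈ F then Real.exp l else 1) * Real.exp (-(l * x)) := by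
    rw [Finset.card_filter]
    push_cast
    refine Finset.sum_le_sum fun s hs => ?_
    rw [hcard s hs, ← Real.exp_add]
    split_ifs with h
    · rw [← Real.exp_zero]
      refine Real.exp_le_exp.2 ?_
      nlinarith
    · positivity
  have h2 : (1 + Real.exp l) / 2 ≤ Real.exp (l ^ 2 / 8 + l / 2) := by
    have h := Real.cosh_le_exp_half_sq (l / 2)
    rw [Real.cosh_eq] at h
    calc (1 + Real.exp l) / 2
        = (Real.exp (l / 2) + Real.exp (-(l / 2))) / 2 * Real.exp (l / 2) := by
          rw [div_mul_eq_mul_div, add_mul, ← Real.exp_add, ← Real.exp_add]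
          norm_num [add_comm]
      _ ≤ Real.exp ((l / 2) ^ 2 / 2) * Real.exp (l / 2) := by gcongr
      _ = _ := by rw [← Real.exp_add]; congr 1; ring
  have h3 : ∏ e ∈ E, (1 + if e ∈ F then Real.exp l else 1) =
      2 ^ E.card * ((1 + Real.exp l) / 2) ^ F.card := by
    have : ∀ e ∈ E, (1 + if e ∈ F then Real.exp l else 1) =
        2 * (if e ∈ F then (1 + Real.exp l) / 2 else 1) := by
      intro e _
      split_ifs <;> ring
    rw [Finset.prod_congr rfl this, Finset.prod_mul_distrib, Finset.prod_const,
      Finset.prod_ite_mem, Finset.inter_eq_right.2 hF, Finset.prod_const]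
  rw [eq_div, div_le_iff₀ (by positivity)]
  refine h1.trans ?_
  rw [← Finset.sum_mul, ← Finset.prod_one_add, h3]
  calc 2 ^ E.card * ((1 + Real.exp l) / 2) ^ F.card * Real.exp (-(l * x))
      ≤ 2 ^ E.card * Real.exp (l ^ 2 / 8 + l / 2) ^ F.card * Real.exp (-(l * x)) := by gcongr
    _ = Real.exp (l ^ 2 * F.card / 8 + l * F.card / 2 - l * x) * 2 ^ E.card := by
        rw [← Real.exp_nat_mul, mul_assoc, ← Real.exp_add, mul_comm]
        congr 2
        ring

end unifProb

/-- The nonzero integer vectors of sup norm at most `r`. -/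
noncomputable def boxOffsets (r : ℕ) : Finset (ℤ × ℤ) :=
  (Finset.Icc (-(r : ℤ)) r ×ˢ Finset.Icc (-(r : ℤ)) r).erase 0

/-- The integer vectors of Euclidean norm at most `R`. -/
noncomputable def discPoints (R : ℕ) : Finset (ℤ × ℤ) :=
  (Finset.Icc (-(R : ℤ)) R ×ˢ Finset.Icc (-(R : ℤ)) R).filter
    (fun b => b.1 ^ 2 + b.2 ^ 2 ≤ (R : ℤ) ^ 2)

lemma mem_boxOffsets {r : ℕ} {o : ℤ × ℤ} :
    o ∈ boxOffsets r ↔ o ≠ 0 ∧ (-(r : ℤ) ≤ o.1 ∧ o.1 ≤ r) ∧ -(r : ℤ) ≤ o.2 ∧ o.2 ≤ r := by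
  simp only [boxOffsets, Finset.mem_erase, Finset.mem_product, Finset.mem_Icc]

lemma mem_discPoints {R : ℕ} {b : ℤ × ℤ} :
    b ∈ discPoints R ↔ b.1 ^ 2 + b.2 ^ 2 ≤ (R : ℤ) ^ 2 := by
  simp only [discPoints, Finset.mem_filter, Finset.mem_product, Finset.mem_Icc,
    and_iff_right_iff_imp]
  intro h
  have h1 := abs_le.1 (abs_le_of_sq_le_sq (by nlinarith [sq_nonneg b.2] : b.1 ^ 2 ≤ (R : ℤ) ^ 2)
    (by positivity))
  have h2 := abs_le.1 (abs_le_of_sq_le_sq (by nlinarith [sq_nonneg b.1] : b.2 ^ 2 ≤ (R : ℤ) ^ 2)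
    (by positivity))
  exact ⟨h1, h2⟩

lemma abs_le_of_mem_discPoints {R : ℕ} {b : ℤ × ℤ} (hb : b ∈ discPoints R) :
    (-(R : ℤ) ≤ b.1 ∧ b.1 ≤ R) ∧ -(R : ℤ) ≤ b.2 ∧ b.2 ≤ R := by
  simp only [discPoints, Finset.mem_filter, Finset.mem_product, Finset.mem_Icc] at hb
  exact hb.1

lemma card_boxOffsets (r : ℕ) : (boxOffsets r).card = 4 * r * (r + 1) := by
  rw [boxOffsets, Finset.card_erase_of_mem (by simp), Finset.card_product, Int.card_Icc]
  have : ((r : ℤ) + 1 - -r).toNat = 2 * r + 1 := by omega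
  rw [this]
  have : (2 * r + 1) * (2 * r + 1) = 4 * r * (r + 1) + 1 := by ring
  omega

lemma card_strip_le (S : Finset (ℤ × ℤ)) (r : ℕ) (a b R : ℤ) (hR : 0 < R) (ha : R ≤ 2 * |a|)
    (hS : ∀ o ∈ S, -(r : ℤ) ≤ o.2 ∧ o.2 ≤ r)
    (hs : ∀ o ∈ S, |a * o.1 + b * o.2| < 2 * R) : S.card ≤ 8 * (2 * r + 1) := by
  have hcard : (Finset.Icc (-(r : ℤ)) r).card = 2 * r + 1 := by
    rw [Int.card_Icc]; omega
  rw [← hcard]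
  refine Finset.card_le_mul_card_image_of_maps_to (f := Prod.snd)
    (fun o ho => Finset.mem_Icc.2 (hS o ho)) 8 fun c _ => ?_
  rcases (S.filter (fun o => o.2 = c)).eq_empty_or_nonempty with h | h
  · simp [h]
  obtain ⟨w, hw, hmin⟩ := Finset.exists_min_image _ Prod.fst h
  have h8 : (Finset.Icc w.1 (w.1 + 7)).card = 8 := by rw [Int.card_Icc]; omega
  rw [← h8]
  simp only [Finset.mem_filter] at hw hmin
  refine Finset.card_le_card_of_injOn Prod.fst (fun o ho => ?_) (fun o ho o' ho' hoo => ?_)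
  · simp only [Finset.coe_filter, Set.mem_ofPred_eq] at ho
    have h1 := abs_lt.1 (hs o ho.1)
    have h2 := abs_lt.1 (hs w hw.1)
    rw [ho.2] at h1
    rw [hw.2] at h2
    have h3 : |a * (o.1 - w.1)| < 4 * R := by
      rw [abs_lt]; constructor <;> nlinarith
    rw [abs_mul, abs_of_nonneg (by linarith [hmin o ho] : 0 ≤ o.1 - w.1)] at h3
    simp only [Finset.coe_Icc, Set.mem_Icc]
    refine ⟨hmin o ho, ?_⟩
    by_contra hlt
    have : 8 ≤ o.1 - w.1 := by omega
    nlinarith [abs_nonneg a]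
  · simp only [Finset.coe_filter, Set.mem_ofPred_eq] at ho ho'
    exact Prod.ext hoo (ho.2.trans ho'.2.symm)

lemma card_box_strip_le (r R : ℕ) (hR : 0 < R) (y : ℤ × ℤ) (hy : y ∉ discPoints R) :
    ((boxOffsets r).filter (fun o => |y.1 * o.1 + y.2 * o.2| < 2 * R)).card ≤
      8 * (2 * r + 1) := by
  rw [mem_discPoints] at hy
  have hor : (R : ℤ) ≤ 2 * |y.1| ∨ (R : ℤ) ≤ 2 * |y.2| := by
    by_contra! h
    nlinarith [sq_abs y.1, sq_abs y.2, abs_nonneg y.1, abs_nonneg y.2]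
  rcases hor with h | h
  · refine card_strip_le _ r y.1 y.2 R (by exact_mod_cast hR) h ?_ ?_ <;> intro o ho <;>
      simp only [Finset.mem_filter, mem_boxOffsets] at ho <;> tauto
  · rw [← Finset.card_map (Equiv.prodComm ℤ ℤ).toEmbedding]
    refine card_strip_le _ r y.2 y.1 R (by exact_mod_cast hR) h ?_ ?_ <;> intro o ho <;>
      simp only [Finset.mem_map, Finset.mem_filter, mem_boxOffsets] at ho <;>
      obtain ⟨o', ho', rfl⟩ := ho
    · exact ho'.1.2.1
    · simpa [add_comm] using ho'.2

lemma two_mul_card_outside_disc_le (r R : ℕ) (hR : r ^ 2 < R) (y : ℤ × ℤ)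
    (hy : y ∉ discPoints R) (hy' : y.1 ^ 2 + y.2 ^ 2 ≤ ((R : ℤ) + 1) ^ 2) :
    2 * ((boxOffsets r).filter (fun o => y + o ∉ discPoints R)).card ≤
      (boxOffsets r).card + 8 * (2 * r + 1) := by
  have hstrip := card_box_strip_le r R (by omega) y hy
  set f : ℤ × ℤ → ℤ := fun o => y.1 * o.1 + y.2 * o.2 with hf
  set O := boxOffsets r with hO
  have hsub : (O.filter (fun o => y + o ∉ discPoints R)) ⊆
      O.filter (fun o => |f o| < 2 * R) ∪ O.filter (fun o => 2 * R ≤ f o) := by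
    intro o ho
    simp only [Finset.mem_union, Finset.mem_filter] at ho ⊢
    by_contra hcon
    have hneg : f o ≤ -(2 * R) := by
      by_contra hlt
      push Not at hcon hlt
      have h2 := hcon.2 ho.1
      have := hcon.1 ho.1
      rw [le_abs] at this
      omega
    refine ho.2 (mem_discPoints.2 ?_)
    have hob := mem_boxOffsets.1 ho.1
    have hR' : (r : ℤ) ^ 2 + 1 ≤ R := by exact_mod_cast hR
    have e1 : o.1 ^ 2 ≤ (r : ℤ) ^ 2 := sq_le_sq' hob.2.1.1 hob.2.1.2
    have e2 : o.2 ^ 2 ≤ (r : ℤ) ^ 2 := sq_le_sq' hob.2.2.1 hob.2.2.2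
    simp only [Prod.fst_add, Prod.snd_add]
    simp only [hf] at hneg
    nlinarith
  have hpm : (O.filter (fun o => 2 * R ≤ f o)).card = (O.filter (fun o => 2 * R ≤ -f o)).card := by
    rw [← Finset.card_map (Equiv.neg (ℤ × ℤ)).toEmbedding]
    congr 1
    ext o
    simp only [Finset.mem_map_equiv, Finset.mem_filter, hO, mem_boxOffsets, hf, Equiv.neg_symm,
      Equiv.neg_apply, Prod.fst_neg, Prod.snd_neg, neg_ne_zero]
    constructor <;> rintro ⟨⟨h1, h2, h3⟩, h4⟩ <;> refine ⟨⟨h1, ?_, ?_⟩, ?_⟩ <;>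
      first | omega | linarith
  have hthree : (O.filter (fun o => |f o| < 2 * R)).card +
      ((O.filter (fun o => 2 * R ≤ f o)).card + (O.filter (fun o => 2 * R ≤ -f o)).card) ≤
        O.card := by
    rw [← Finset.card_union_of_disjoint, ← Finset.card_union_of_disjoint]
    · refine Finset.card_le_card ?_
      intro o
      simp only [Finset.mem_union, Finset.mem_filter]
      tauto
    · rw [Finset.disjoint_left]
      intro o
      simp only [Finset.mem_union, Finset.mem_filter, abs_lt]
      omega
    · rw [Finset.disjoint_left]
      intro o
      simp only [Finset.mem_filter]
      omega
  have := (Finset.card_le_card hsub).trans (Finset.card_union_le _ _)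
  change (O.filter (fun o => |f o| < 2 * R)).card ≤ _ at hstrip
  omega

lemma card_outside_disc_le (a : ℝ) (r R : ℕ) (hr : 2 ≤ r * a) (hR : r ^ 2 < R)
    (y : ℤ × ℤ) (hy : y ∉ discPoints R) (hy' : y.1 ^ 2 + y.2 ^ 2 ≤ ((R : ℤ) + 1) ^ 2) :
    (((boxOffsets r).filter (fun o => y + o ∉ discPoints R)).card : ℝ) ≤
      (1 / 2 + a) * (boxOffsets r).card := by
  have h : (2 : ℝ) * ((boxOffsets r).filter (fun o => y + o ∉ discPoints R)).card ≤
      (boxOffsets r).card + 8 * (2 * r + 1) := by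
    exact_mod_cast two_mul_card_outside_disc_le r R hR y hy hy'
  have hK : ((boxOffsets r).card : ℝ) = 4 * r * (r + 1) := by
    rw [card_boxOffsets]; push_cast; ring
  have h0 : (0 : ℝ) ≤ r + 1 := by positivity
  have h1 := mul_le_mul_of_nonneg_right hr h0
  rw [hK] at h ⊢
  linarith

section BlowUp

variable {V T : Type*}

/-- The vertices lying over `t`. -/
noncomputable def cluster [Fintype V] (π : V → T) (t : T) : Finset V :=
  Finset.univ.filter (fun v => π v = t)

/-- The edges of `G` with an endpoint over `U`. -/
def edgesOver (G : SimpleGraph V) (π : V → T) (U : Set T) : Set (Sym2 V) :=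
  {e | e ∈ G.edgeSet ∧ ∃ x ∈ e, π x ∈ U}

lemma edgesOver_mono {G : SimpleGraph V} {π : V → T} {U U' : Set T} (h : U ⊆ U') :
    edgesOver G π U ⊆ edgesOver G π U' :=
  fun _ he => ⟨he.1, he.2.imp fun _ hx => ⟨hx.1, h hx.2⟩⟩

lemma mem_cluster [Fintype V] {π : V → T} {t : T} {v : V} : v ∈ cluster π t ↔ π v = t := by
  simp [cluster]

lemma card_edgesOver_le [Fintype V] {G : SimpleGraph V} {π : V → T} {k m : ℕ}
    (hreg : G.IsRegularOfDegree k) (hm : ∀ t, (cluster π t).card = m) (U : Finset T) :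
    (G.edgeSet.toFinset.filter (· ∈ edgesOver G π U)).card ≤ U.card * m * k := by
  have hsub : G.edgeSet.toFinset.filter (· ∈ edgesOver G π U) ⊆
      (U.biUnion (cluster π)).biUnion (fun x => G.incidenceFinset x) := by
    intro e he
    obtain ⟨-, he, x, hx, hxU⟩ := Finset.mem_filter.1 he
    simp only [Finset.mem_biUnion, SimpleGraph.mem_incidenceFinset, mem_cluster]
    exact ⟨x, ⟨_, hxU, rfl⟩, he, hx⟩
  refine (Finset.card_le_card hsub).trans ?_
  refine (Finset.card_biUnion_le_card_mul _ _ k fun x _ => ?_).trans ?_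
  · rw [SimpleGraph.card_incidenceFinset_eq_degree, hreg x]
  · gcongr
    exact Finset.card_biUnion_le_card_mul _ _ _ fun t _ => (hm t).le

variable [AddCommGroup T]

/-- The pairs joining `W` to the clusters over `t + S`. -/
noncomputable def pairsBetween [Fintype V] (π : V → T) (W : Finset V) (t : T) (S : Finset T) :
    Finset (Sym2 V) :=
  (W ×ˢ S.biUnion (fun n => cluster π (t + n))).image (fun p => s(p.1, p.2))

/-- Some `q` vertices over `t` send at least `q * θ` edges of `ω` to at most a
`1 / 2 + a` proportion of the neighbouring clusters. -/
def Overloaded [Fintype V] (π : V → T) (N : Finset T) (a θ : ℝ) (q : ℕ) (t : T)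
    (ω : Finset (Sym2 V)) : Prop :=
  ∃ S ∈ N.powerset.filter (fun S => (S.card : ℝ) ≤ (1 / 2 + a) * N.card),
    ∃ W ∈ (cluster π t).powersetCard q, q * θ ≤ ((ω ∩ pairsBetween π W t S).card : ℝ)

/-- Every vertex of `H` has at least `θ` neighbours in `H` along `ω`. -/
def MinDegreeGE (ω : Finset (Sym2 V)) (θ : ℝ) (H : Finset V) : Prop :=
  ∀ v ∈ H, θ ≤ ((H.filter (fun u => s(v, u) ∈ ω)).card : ℝ)

/-- Fewer than `q` vertices of `H` lie over `t`. -/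
def Depleted (π : V → T) (q : ℕ) (H : Finset V) (t : T) : Prop :=
  (H.filter (fun v => π v = t)).card < q

variable {π : V → T} {N : Finset T} {G : SimpleGraph V} {q : ℕ} {θ θ₀ a : ℝ}
  {ω : Finset (Sym2 V)} {H : Finset V} {t : T}

lemma card_biUnion_depleted_le (N' : Finset T) (h : ∀ n ∈ N', Depleted π q H (t + n)) :
    (N'.biUnion (fun n => H.filter (fun v => π v = t + n))).card ≤ N'.card * q :=
  Finset.card_biUnion_le_card_mul _ _ _ fun n hn => (h n hn).le

lemma disjoint_edgesOver (hG : ∀ u v, G.Adj u v ↔ π v - π u ∈ N) {U U' : Set T}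
    (h : ∀ u ∈ U, ∀ u' ∈ U', u' ≠ u ∧ u' - u ∉ N) :
    Disjoint (edgesOver G π U) (edgesOver G π U') := by
  rw [Set.disjoint_left]
  rintro e ⟨he, x, hx, hxU⟩ ⟨-, y, hy, hyU⟩
  have hne : x ≠ y := by
    rintro rfl
    exact (h _ hxU _ hyU).1 rfl
  rw [(Sym2.mem_and_mem_iff hne).1 ⟨hx, hy⟩, SimpleGraph.mem_edgeSet, hG] at he
  exact (h _ hxU _ hyU).2 he

variable [Fintype V]

lemma pairsBetween_subset (hG : ∀ u v, G.Adj u v ↔ π v - π u ∈ N) {W : Finset V} {S : Finset T}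
    (hS : S ⊆ N) (hW : W ⊆ cluster π t) {e : Sym2 V} (he : e ∈ pairsBetween π W t S) :
    e ∈ edgesOver G π {t} := by
  simp only [pairsBetween, Finset.mem_image, Finset.mem_product, Finset.mem_biUnion,
    mem_cluster, Prod.exists] at he
  obtain ⟨x, y, ⟨hx, n, hn, hy⟩, rfl⟩ := he
  have hx' := mem_cluster.1 (hW hx)
  refine ⟨?_, x, by simp, hx'⟩
  rw [SimpleGraph.mem_edgeSet, hG, hy, hx']
  simpa using hS hn

lemma Overloaded.detBy (hG : ∀ u v, G.Adj u v ↔ π v - π u ∈ N) :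
    DetBy (Overloaded π N a θ q t) (edgesOver G π {t}) := by
  intro s s' h
  have key : ∀ S ⊆ N, ∀ W ⊆ cluster π t,
      s ∩ pairsBetween π W t S = s' ∩ pairsBetween π W t S := by
    intro S hS W hW
    ext e
    simp only [Finset.mem_inter, and_congr_left_iff]
    exact fun he => h e (pairsBetween_subset hG hS hW he)
  unfold Overloaded
  refine exists_congr fun S => and_congr_right fun hS => exists_congr fun W =>
    and_congr_right fun hW => ?_
  rw [key S (Finset.mem_powerset.1 (Finset.mem_filter.1 hS).1) W (Finset.mem_powersetCard.1 hW).1]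

lemma Overloaded.mono {ω' : Finset (Sym2 V)} (h : ω ⊆ ω') (ho : Overloaded π N a θ q t ω) :
    Overloaded π N a θ q t ω' := by
  obtain ⟨S, hS, W, hW, hle⟩ := ho
  refine ⟨S, hS, W, hW, hle.trans ?_⟩
  gcongr

lemma card_pairsBetween_le {m : ℕ} (hm : ∀ t, (cluster π t).card = m) (W : Finset V)
    (S : Finset T) : (pairsBetween π W t S).card ≤ W.card * (S.card * m) := by
  refine Finset.card_image_le.trans ?_
  rw [Finset.card_product]
  gcongr
  exact Finset.card_biUnion_le_card_mul _ _ _ fun n _ => (hm _).le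

lemma chernoff_exponent_le {a w k F θ : ℝ} (ha : 0 ≤ a) (hw : 0 ≤ w) (h1 : F ≤ w * k)
    (h2 : F ≤ (1 / 2 + a) * (w * k)) (hθ : k / 4 + 3 / 4 * a * k ≤ θ) :
    a ^ 2 * F / 8 + a * F / 2 - a * (w * θ) ≤ -(a ^ 2 * (w * k) / 8) := by
  have e1 := mul_le_mul_of_nonneg_left h1 (sq_nonneg a)
  have e2 := mul_le_mul_of_nonneg_left h2 ha
  have e3 := mul_le_mul_of_nonneg_left hθ (mul_nonneg ha hw)
  linarith

lemma unifProb_le_card_pairsBetween (hG : ∀ u v, G.Adj u v ↔ π v - π u ∈ N) {m : ℕ}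
    (hm : ∀ t, (cluster π t).card = m) (ha : 0 < a)
    (hθ : (m * N.card : ℝ) / 4 + 3 / 4 * a * (m * N.card) ≤ θ) {S : Finset T} (hSN : S ⊆ N)
    (hS : (S.card : ℝ) ≤ (1 / 2 + a) * N.card) {W : Finset V} (hW : W ⊆ cluster π t) :
    unifProb G.edgeSet.toFinset
        (fun ω => W.card * θ ≤ ((ω ∩ pairsBetween π W t S).card : ℝ)) ≤
      Real.exp (-(a ^ 2 * (W.card * (m * N.card)) / 8)) := by
  have hF : pairsBetween π W t S ⊆ G.edgeSet.toFinset := by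
    intro e he
    rw [Set.mem_toFinset]
    exact (pairsBetween_subset hG hSN hW he).1
  refine (unifProb.chernoff _ hF _ a ha.le).trans (Real.exp_le_exp.2 ?_)
  have h1 : ((pairsBetween π W t S).card : ℝ) ≤ W.card * (S.card * m) := by
    exact_mod_cast card_pairsBetween_le hm W S
  have h2 : (S.card : ℝ) ≤ N.card := by exact_mod_cast Finset.card_le_card hSN
  refine chernoff_exponent_le ha.le (Nat.cast_nonneg _) ?_ ?_ hθ
  · rw [mul_comm (m : ℝ)]
    exact h1.trans (by gcongr)
  · refine h1.trans ?_
    calc (W.card : ℝ) * (S.card * m) ≤ W.card * ((1 / 2 + a) * N.card * m) := by gcongr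
      _ = _ := by ring

/-- Clusters are overloaded with probability exponentially small in `q * k`. -/
lemma unifProb_overloaded_le (hG : ∀ u v, G.Adj u v ↔ π v - π u ∈ N) {m : ℕ}
    (hm : ∀ t, (cluster π t).card = m) (ha : 0 < a)
    (hθ : (m * N.card : ℝ) / 4 + 3 / 4 * a * (m * N.card) ≤ θ) :
    unifProb G.edgeSet.toFinset (Overloaded π N a θ q t) ≤
      2 ^ N.card * (2 ^ m * Real.exp (-(a ^ 2 * (q * (m * N.card)) / 8))) := by
  set b := Real.exp (-(a ^ 2 * (q * (m * N.card)) / 8)) with hb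
  have hstep : ∀ S ∈ N.powerset.filter (fun S => (S.card : ℝ) ≤ (1 / 2 + a) * N.card),
      unifProb G.edgeSet.toFinset (fun ω => ∃ W ∈ (cluster π t).powersetCard q,
        q * θ ≤ ((ω ∩ pairsBetween π W t S).card : ℝ)) ≤ 2 ^ m * b := by
    intro S hS
    obtain ⟨hSN, hS⟩ := Finset.mem_filter.1 hS
    refine (unifProb.exists_le_card_mul _
      (fun W ω => q * θ ≤ ((ω ∩ pairsBetween π W t S).card : ℝ)) b fun W hW => ?_).trans ?_
    · obtain ⟨hWt, rfl⟩ := Finset.mem_powersetCard.1 hW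
      exact unifProb_le_card_pairsBetween hG hm ha hθ (Finset.mem_powerset.1 hSN) hS hWt
    · gcongr
      rw [Finset.card_powersetCard, hm]
      exact_mod_cast Nat.choose_le_two_pow m q
  refine (unifProb.exists_le_card_mul _ _ _ hstep).trans ?_
  gcongr
  have := Finset.card_filter_le N.powerset (fun S => (S.card : ℝ) ≤ (1 / 2 + a) * N.card)
  rw [Finset.card_powerset] at this
  exact_mod_cast this

/-- If all but slightly more than half of the clusters next to `t` are depleted, so is `t`. -/
lemma Depleted.of_neighbours (hG : ∀ u v, G.Adj u v ↔ π v - π u ∈ N)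
    (hω : ω ⊆ G.edgeSet.toFinset) (hH : MinDegreeGE ω θ₀ H) (hθ : θ + N.card * q ≤ θ₀)
    (ht : ¬ Overloaded π N a θ q t ω) {S : Finset T} (hSN : S ⊆ N)
    (hS : (S.card : ℝ) ≤ (1 / 2 + a) * N.card) (hd : ∀ n ∈ N \ S, Depleted π q H (t + n)) :
    Depleted π q H t := by
  by_contra hcon
  obtain ⟨W, hWH, hWq⟩ := Finset.exists_subset_card_eq (not_lt.1 hcon)
  have hWt : ∀ x ∈ W, x ∈ H ∧ π x = t := fun x hx => Finset.mem_filter.1 (hWH hx)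
  refine ht ⟨S, by simp only [Finset.mem_filter, Finset.mem_powerset]; exact ⟨hSN, hS⟩, W,
    Finset.mem_powersetCard.2 ⟨fun x hx => mem_cluster.2 (hWt x hx).2, hWq⟩, ?_⟩
  set U := S.biUnion (fun n => cluster π (t + n)) with hU
  have hdeg : ∀ x ∈ W, θ ≤ ((U.filter (fun u => s(x, u) ∈ ω)).card : ℝ) := by
    intro x hx
    have hsub : H.filter (fun u => s(x, u) ∈ ω) ⊆ U.filter (fun u => s(x, u) ∈ ω) ∪
        (N \ S).biUnion (fun n => H.filter (fun v => π v = t + n)) := by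
      intro u hu
      obtain ⟨huH, hux⟩ := Finset.mem_filter.1 hu
      have hadj := Set.mem_toFinset.1 (hω hux)
      rw [SimpleGraph.mem_edgeSet, hG, (hWt x hx).2] at hadj
      simp only [Finset.mem_union, Finset.mem_filter, hU, Finset.mem_biUnion, mem_cluster,
        Finset.mem_sdiff]
      by_cases hn : π u - t ∈ S
      · exact Or.inl ⟨⟨_, hn, by abel⟩, hux⟩
      · exact Or.inr ⟨_, ⟨hadj, hn⟩, huH, by abel⟩
    have h1 := (Finset.card_le_card hsub).trans (Finset.card_union_le _ _)
    have h2 := card_biUnion_depleted_le (N \ S) hd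
    have h3 := Nat.mul_le_mul_right q (Finset.card_le_card (Finset.sdiff_subset (s := N) (t := S)))
    have h4 : ((H.filter (fun u => s(x, u) ∈ ω)).card : ℝ) ≤
        (U.filter (fun u => s(x, u) ∈ ω)).card + N.card * q := by
      exact_mod_cast h1.trans (by omega)
    linarith [hH x (hWt x hx).1]
  have hcount : ∑ x ∈ W, (U.filter (fun u => s(x, u) ∈ ω)).card ≤
      (ω ∩ pairsBetween π W t S).card := by
    rw [← Finset.card_sigma]
    refine Finset.card_le_card_of_injOn (fun p => s(p.1, p.2)) ?_ ?_
    · rintro ⟨x, u⟩ hp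
      simp only [Finset.coe_sigma, Set.mem_sigma_iff, Finset.mem_coe, Finset.mem_filter] at hp
      simp only [Finset.coe_inter, Set.mem_inter_iff, Finset.mem_coe, pairsBetween]
      exact ⟨hp.2.2, Finset.mem_image.2 ⟨(x, u), Finset.mem_product.2 ⟨hp.1, hp.2.1⟩, rfl⟩⟩
    · rintro ⟨x, u⟩ hp ⟨x', u'⟩ hp' heq
      simp only [Finset.coe_sigma, Set.mem_sigma_iff, Finset.mem_coe, Finset.mem_filter] at hp hp'
      rcases Sym2.eq_iff.1 heq with ⟨h1, h2⟩ | ⟨h1, h2⟩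
      · simp only at h1 h2
        subst h1 h2
        rfl
      · simp only at h1 h2
        subst h1 h2
        exfalso
        have hu := hp.2.1
        simp only [hU, Finset.mem_biUnion, mem_cluster] at hu
        obtain ⟨n, hn, hu⟩ := hu
        rw [(hWt u hp'.1).2] at hu
        have hn0 : n = 0 := by simpa using hu
        exact G.loopless.irrefl x ((hG x x).2 (by simpa [hn0] using hSN hn))
  calc (q : ℝ) * θ = ∑ _x ∈ W, θ := by simp [hWq]
    _ ≤ ∑ x ∈ W, ((U.filter (fun u => s(x, u) ∈ ω)).card : ℝ) := Finset.sum_le_sum hdeg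
    _ ≤ _ := by exact_mod_cast hcount

lemma notMem_of_neighbours_depleted (hG : ∀ u v, G.Adj u v ↔ π v - π u ∈ N)
    (hω : ω ⊆ G.edgeSet.toFinset) (hH : MinDegreeGE ω θ₀ H) (hθ : N.card * q < θ₀) {v : V}
    (hd : ∀ n ∈ N, Depleted π q H (π v + n)) : v ∉ H := by
  intro hv
  have hsub : H.filter (fun u => s(v, u) ∈ ω) ⊆
      N.biUnion (fun n => H.filter (fun u => π u = π v + n)) := by
    intro u hu
    obtain ⟨huH, hux⟩ := Finset.mem_filter.1 hu
    have hadj := Set.mem_toFinset.1 (hω hux)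
    rw [SimpleGraph.mem_edgeSet, hG] at hadj
    simp only [Finset.mem_biUnion, Finset.mem_filter]
    exact ⟨_, hadj, huH, by abel⟩
  have h1 := (Finset.card_le_card hsub).trans (card_biUnion_depleted_le N hd)
  have h2 : ((H.filter (fun u => s(v, u) ∈ ω)).card : ℝ) ≤ N.card * q := by exact_mod_cast h1
  linarith [hH v hv]

lemma isRegularOfDegree_blowUp (hG : ∀ u v, G.Adj u v ↔ π v - π u ∈ N) {m : ℕ}
    (hm : ∀ t, (cluster π t).card = m) : G.IsRegularOfDegree (m * N.card) := by
  intro v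
  have : G.neighborFinset v = N.biUnion (fun n => cluster π (π v + n)) := by
    ext u
    simp only [SimpleGraph.mem_neighborFinset, hG, Finset.mem_biUnion, mem_cluster]
    exact ⟨fun h => ⟨_, h, by abel⟩, fun ⟨n, hn, h⟩ => by simpa [h] using hn⟩
  rw [← SimpleGraph.card_neighborFinset_eq_degree, this, Finset.card_biUnion]
  · simp [hm, mul_comm]
  · intro n _ n' _ hne
    refine Finset.disjoint_left.2 fun u hu hu' => ?_
    rw [mem_cluster] at hu hu'
    exact hne (add_left_cancel (hu.symm.trans hu'))

end BlowUp

section Percolation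

variable {V T Ω : Type*} [AddCommGroup T]

/-- The sites of the disc of radius `R` about `t`. -/
noncomputable def drop (φ : ℤ × ℤ →+ T) (R : ℕ) (t : T) : Finset T :=
  (discPoints R).image (fun b => t + φ b)

/-- No site of the disc about `t` is bad. -/
def SiteGood (bad : T → Ω → Prop) (φ : ℤ × ℤ →+ T) (R : ℕ) (t : T) (ω : Ω) : Prop :=
  ∀ s ∈ drop φ R t, ¬ bad s ω

/-- The discs about all sites of the column `x` are free of bad sites. -/
def ColGood (bad : T → Ω → Prop) (φ : ℤ × ℤ →+ T) (R : ℕ) (x : ℤ) (ω : Ω) : Prop :=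
  ∀ y : ℤ, SiteGood bad φ R (φ (x, y)) ω

/-- Every site of the disc about `t` is depleted. -/
def DropDepleted (π : V → T) (φ : ℤ × ℤ →+ T) (q : ℕ) (H : Finset V) (R : ℕ) (t : T) : Prop :=
  ∀ s ∈ drop φ R t, Depleted π q H s

/-- No edge of `ω` meets the disc about `t`. -/
def Seed (G : SimpleGraph V) (π : V → T) (φ : ℤ × ℤ →+ T) (R : ℕ) (t : T)
    (ω : Finset (Sym2 V)) : Prop :=
  ∀ e ∈ ω, e ∉ edgesOver G π (drop φ R t)

/-- A property of lattice points that is inherited by the right and upper neighbours of a point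
whenever these are good, and that is vertically periodic, reaches the column `x₀` along good rows
and columns. -/
lemma forall_column_of_chain {P good : ℤ × ℤ → Prop} {M : ℤ} (hM : 0 < M)
    (hx : ∀ x y, P (x, y) → good (x + 1, y) → P (x + 1, y))
    (hy : ∀ x y, P (x, y) → good (x, y + 1) → P (x, y + 1))
    (hper : ∀ x y, P (x, y) → P (x, y - M)) {x₀ : ℤ} {J : ℕ}
    (h₀ : ∀ y, good (x₀, y))
    (hseed : ∃ i : ℕ, i < J ∧ P (x₀ - (J - i) * M, 0) ∧ ∀ y, good (x₀ - (J - i) * M, y))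
    (hrow : ∀ i : ℕ, i < J → ∃ y : ℤ, ∀ d : ℤ, 0 ≤ d → d < 2 * M →
      good (x₀ - (J - i) * M + d, y))
    (hcol : ∀ i : ℕ, i < J → ∃ c : ℤ, 0 ≤ c ∧ c < M ∧ ∀ y, good (x₀ - (J - i) * M + c, y)) :
    ∀ y, P (x₀, y) := by
  have column : ∀ x y, P (x, y) → (∀ y, good (x, y)) → ∀ y', P (x, y') := by
    intro x y hP hgood y'
    have up : ∀ (j : ℕ) y, P (x, y) → P (x, y + j) := by
      intro j y hP
      induction j with
      | zero => simpa using hP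
      | succ j ih =>
        have := hy x _ ih (hgood _)
        push_cast
        rwa [← add_assoc]
    have down : ∀ (j : ℕ) y, P (x, y) → P (x, y - j * M) := by
      intro j y hP
      induction j with
      | zero => simpa using hP
      | succ j ih =>
        have := hper x _ ih
        push_cast
        convert this using 2
        ring
    have h1 := down (y - y').natAbs y hP
    have h2 : y - (y - y').natAbs * M ≤ y' := by
      have : y - y' ≤ (y - y').natAbs := Int.le_natAbs
      nlinarith
    have h3 := up (y' - (y - (y - y').natAbs * M)).toNat _ h1
    rw [Int.toNat_of_nonneg (by linarith)] at h3
    convert h3 using 2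
    ring
  have row : ∀ (x y : ℤ) (j : ℕ), P (x, y) → (∀ i : ℤ, 0 ≤ i → i ≤ j → good (x + i, y)) →
      P (x + j, y) := by
    intro x y j hP hgood
    induction j with
    | zero => simpa using hP
    | succ j ih =>
      have := hx _ _ (ih fun i h0 hi => hgood i h0 (by push_cast; linarith))
        (by simpa [add_assoc] using hgood (j + 1) (by positivity) (by push_cast; rfl))
      push_cast
      rwa [← add_assoc]
  have cross : ∀ i : ℕ, i < J → ∀ c y : ℤ, 0 ≤ c → c < M → P (x₀ - (J - i) * M + c, y) →
      (∀ y, good (x₀ - (J - i) * M + c, y)) →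
      ∃ y, ∀ d : ℤ, M ≤ d → d < 2 * M → P (x₀ - (J - i) * M + d, y) := by
    intro i hi c y hc hcM hP hgood
    obtain ⟨y', hy'⟩ := hrow i hi
    refine ⟨y', fun d hd hd' => ?_⟩
    have := row _ y' (d - c).toNat (column _ _ hP hgood y') fun j h0 hj => by
      rw [Int.toNat_of_nonneg (by linarith)] at hj
      rw [add_assoc]
      exact hy' _ (by linarith) (by linarith)
    rw [Int.toNat_of_nonneg (by linarith)] at this
    convert this using 2
    ring
  obtain ⟨i₀, hi₀, hP, hgood⟩ := hseed
  have hind : ∀ j : ℕ, i₀ + j < J →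
      ∃ y, ∀ d : ℤ, M ≤ d → d < 2 * M → P (x₀ - (J - (i₀ + j : ℕ)) * M + d, y) := by
    intro j hj
    induction j with
    | zero => exact cross _ hj 0 0 le_rfl hM (by simpa using hP) (by simpa using hgood)
    | succ j ih =>
      obtain ⟨y, hy⟩ := ih (by omega)
      obtain ⟨c, hc, hcM, hgood⟩ := hcol _ hj
      refine cross _ hj c y hc hcM ?_ hgood
      have := hy (M + c) (by linarith) (by linarith)
      convert this using 2
      push_cast
      ring
  obtain ⟨y, hy⟩ := hind (J - 1 - i₀) (by omega)
  have h1 := hy M le_rfl (by linarith)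
  have h2 : ((i₀ + (J - 1 - i₀) : ℕ) : ℤ) = J - 1 := by omega
  have h3 : x₀ - (J - (i₀ + (J - 1 - i₀) : ℕ)) * M + M = x₀ := by
    rw [h2]
    ring
  rw [h3] at h1
  exact column _ _ h1 h₀

/-- The configuration around the column `x₀` that forces it to be depleted. -/
def Nice (G : SimpleGraph V) (bad : T → Finset (Sym2 V) → Prop) (π : V → T) (φ : ℤ × ℤ →+ T)
    (R D h J : ℕ) (x₀ : ℤ) (ω : Finset (Sym2 V)) : Prop :=
  ColGood bad φ R x₀ ω ∧
  (∃ i ∈ Finset.range J, Seed G π φ R (φ (x₀ - (J - i) * (h * D), 0)) ω ∧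
    ColGood bad φ R (x₀ - (J - i) * (h * D)) ω) ∧
  (∀ i ∈ Finset.range J, ∃ b ∈ Finset.range h, ∀ d ∈ Finset.range (2 * (h * D)),
    SiteGood bad φ R (φ (x₀ - (J - i) * (h * D) + d, b * D)) ω) ∧
  (∀ i ∈ Finset.range J, ∃ c ∈ Finset.range h,
    ColGood bad φ R (x₀ - (J - i) * (h * D) + c * D) ω)

variable {G : SimpleGraph V} {π : V → T} {φ : ℤ × ℤ →+ T} {r R q : ℕ} {θ θ₀ a : ℝ}
  {ω : Finset (Sym2 V)} {H : Finset V} {t : T}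

lemma Seed.dropDepleted (hω : ∀ e ∈ ω, e ∈ G.edgeSet) (hH : MinDegreeGE ω θ₀ H) (hθ : 0 < θ₀)
    (hq : 0 < q) (h : Seed G π φ R t ω) : DropDepleted π φ q H R t := by
  intro s hs
  unfold Depleted
  rw [Finset.card_eq_zero.2]
  · exact hq
  · refine Finset.filter_eq_empty_iff.2 fun v hv hvs => ?_
    have h1 : (0 : ℝ) < _ := hθ.trans_le (hH v hv)
    obtain ⟨u, hu⟩ := Finset.card_pos.1 (Nat.cast_pos.1 h1)
    have hu := (Finset.mem_filter.1 hu).2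
    exact h _ hu ⟨hω _ hu, v, by simp, by simpa [hvs] using hs⟩

variable [Fintype V]

lemma DropDepleted.step
    (hG : ∀ u v, G.Adj u v ↔ π v - π u ∈ (boxOffsets r).image φ)
    (hN : ((boxOffsets r).image φ).card = (boxOffsets r).card)
    (hω : ω ⊆ G.edgeSet.toFinset) (hH : MinDegreeGE ω θ₀ H)
    (hθ : θ + (boxOffsets r).card * q ≤ θ₀) (hr : 2 ≤ r * a) (hR : r ^ 2 < R) {e : ℤ × ℤ}
    (he : e = (1, 0) ∨ e = (0, 1)) (h : DropDepleted π φ q H R t)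
    (hgood : SiteGood (Overloaded π ((boxOffsets r).image φ) a θ q) φ R (t + φ e) ω) :
    DropDepleted π φ q H R (t + φ e) := by
  intro s hs
  obtain ⟨b, hb, rfl⟩ := Finset.mem_image.1 hs
  have hgood := hgood _ hs
  have hdrop : ∀ y ∈ discPoints R, Depleted π q H (t + φ y) :=
    fun y hy => h _ (Finset.mem_image_of_mem _ hy)
  obtain ⟨y, hy⟩ : ∃ y, y = e + b := ⟨_, rfl⟩
  rw [add_assoc, ← map_add, ← hy] at hgood ⊢
  by_cases hyR : y ∈ discPoints R
  · exact hdrop y hyR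
  have hy' : y.1 ^ 2 + y.2 ^ 2 ≤ ((R : ℤ) + 1) ^ 2 := by
    have h1 := mem_discPoints.1 hb
    have h2 := abs_le_of_mem_discPoints hb
    rcases he with rfl | rfl <;> rw [hy] <;> simp only [Prod.fst_add, Prod.snd_add] <;> nlinarith
  refine Depleted.of_neighbours hG hω hH (by rwa [hN]) hgood
    (S := ((boxOffsets r).filter (fun o => y + o ∉ discPoints R)).image φ)
    (Finset.image_subset_image (Finset.filter_subset _ _)) ?_ ?_
  · rw [hN]
    refine le_trans ?_ (card_outside_disc_le a r R hr hR y hyR hy')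
    exact_mod_cast Finset.card_image_le
  · intro n hn
    obtain ⟨hn1, hn2⟩ := Finset.mem_sdiff.1 hn
    obtain ⟨o, ho, rfl⟩ := Finset.mem_image.1 hn1
    rw [add_assoc, ← map_add]
    refine hdrop _ ?_
    by_contra hcon
    exact hn2 (Finset.mem_image_of_mem _ (Finset.mem_filter.2 ⟨ho, hcon⟩))

lemma Nice.depleted
    (hG : ∀ u v, G.Adj u v ↔ π v - π u ∈ (boxOffsets r).image φ)
    (hN : ((boxOffsets r).image φ).card = (boxOffsets r).card)
    (hω : ω ⊆ G.edgeSet.toFinset) (hH : MinDegreeGE ω θ₀ H)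
    (hθ : θ + (boxOffsets r).card * q ≤ θ₀) (hθ₀ : 0 < θ₀) (hq : 0 < q)
    (hr : 2 ≤ r * a) (hR : r ^ 2 < R) {D h J : ℕ} (hM : 0 < h * D)
    (hφ : φ (0, ((h * D : ℕ) : ℤ)) = 0) {x₀ : ℤ}
    (hnice : Nice G (Overloaded π ((boxOffsets r).image φ) a θ q) π φ R D h J x₀ ω) (y₀ : ℤ) :
    Depleted π q H (φ (x₀, y₀)) := by
  obtain ⟨h1, ⟨i₀, hi₀, hs, hg⟩, h3, h4⟩ := hnice
  have hstep : ∀ z e : ℤ × ℤ, e = (1, 0) ∨ e = (0, 1) → DropDepleted π φ q H R (φ z) →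
      SiteGood (Overloaded π ((boxOffsets r).image φ) a θ q) φ R (φ (z + e)) ω →
      DropDepleted π φ q H R (φ (z + e)) := by
    intro z e he hz hgood
    rw [map_add] at hgood ⊢
    exact DropDepleted.step hG hN hω hH hθ hr hR he hz hgood
  have hω' : ∀ e ∈ ω, e ∈ G.edgeSet := fun e he => Set.mem_toFinset.1 (hω he)
  have hMZ : (0 : ℤ) < h * D := by exact_mod_cast hM
  have key : ∀ y, DropDepleted π φ q H R (φ (x₀, y)) := by
    refine forall_column_of_chain (P := fun z => DropDepleted π φ q H R (φ z))
      (good := fun z => SiteGood (Overloaded π ((boxOffsets r).image φ) a θ q) φ R (φ z) ω)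
      (J := J) hMZ ?_ ?_ ?_ h1 ⟨i₀, Finset.mem_range.1 hi₀, hs.dropDepleted hω' hH hθ₀ hq, hg⟩ ?_ ?_
    · intro x y hP hgood
      simpa using hstep (x, y) (1, 0) (Or.inl rfl) hP (by simpa using hgood)
    · intro x y hP hgood
      simpa using hstep (x, y) (0, 1) (Or.inr rfl) hP (by simpa using hgood)
    · intro x y hP
      have : ((x, y) : ℤ × ℤ) = (x, y - h * D) + (0, ((h * D : ℕ) : ℤ)) := by simp
      rw [this, map_add, hφ, add_zero] at hP
      exact hP
    · intro i hi
      obtain ⟨b, -, hb⟩ := h3 i (Finset.mem_range.2 hi)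
      refine ⟨b * D, fun d hd hd' => ?_⟩
      have := hb d.toNat (Finset.mem_range.2 (by zify; rw [Int.toNat_of_nonneg hd]; linarith))
      rwa [Int.toNat_of_nonneg hd] at this
    · intro i hi
      obtain ⟨c, hc, hcol⟩ := h4 i (Finset.mem_range.2 hi)
      refine ⟨c * D, by positivity, ?_, hcol⟩
      have hD : 0 < D := Nat.pos_of_mul_pos_left hM
      exact_mod_cast Nat.mul_lt_mul_of_pos_right (Finset.mem_range.1 hc) hD
  have := key y₀ (φ (x₀, y₀)) (Finset.mem_image.2 ⟨0, by rw [mem_discPoints]; simp, by simp⟩)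
  exact this

end Percolation

section Probability

variable {V T : Type*} [AddCommGroup T]

/-- The sites at horizontal distance at most `R` from the column `x`. -/
def colStrip (φ : ℤ × ℤ →+ T) (R : ℕ) (x : ℤ) : Set T :=
  {t | ∃ b y : ℤ, |b| ≤ R ∧ t = φ (x + b, y)}

/-- The sites at vertical distance at most `R` from the row `y`. -/
def rowStrip (φ : ℤ × ℤ →+ T) (R : ℕ) (y : ℤ) : Set T :=
  {t | ∃ b x : ℤ, |b| ≤ R ∧ t = φ (x, y + b)}

lemma drop_subset_colStrip (φ : ℤ × ℤ →+ T) (R : ℕ) (x y : ℤ) :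
    (drop φ R (φ (x, y)) : Set T) ⊆ colStrip φ R x := by
  intro t ht
  obtain ⟨b, hb, rfl⟩ := Finset.mem_image.1 ht
  exact ⟨b.1, y + b.2, abs_le.2 (abs_le_of_mem_discPoints hb).1, by rw [← map_add]; rfl⟩

lemma drop_subset_rowStrip (φ : ℤ × ℤ →+ T) (R : ℕ) (x y : ℤ) :
    (drop φ R (φ (x, y)) : Set T) ⊆ rowStrip φ R y := by
  intro t ht
  obtain ⟨b, hb, rfl⟩ := Finset.mem_image.1 ht
  exact ⟨b.2, x + b.1, abs_le.2 (abs_le_of_mem_discPoints hb).2, by rw [← map_add]; rfl⟩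

lemma card_drop_le (φ : ℤ × ℤ →+ T) (R : ℕ) (t : T) :
    (drop φ R t).card ≤ (discPoints R).card := Finset.card_image_le

lemma not_dvd_of_spacing {D W h L : ℕ} (hD : W < D) (hL : h * D ≤ L) {c c' : ℕ} (hc : c < h)
    (hc' : c' < h) (hne : c ≠ c') {e : ℤ} (he : |e| ≤ W) :
    ¬ (L : ℤ) ∣ ((c' : ℤ) - c) * D + e := by
  intro hdvd
  obtain ⟨he1, he2⟩ := abs_le.1 he
  have hD' : (W : ℤ) < D := by exact_mod_cast hD
  have hL' : (h : ℤ) * D ≤ L := by exact_mod_cast hL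
  have hc1 : (c : ℤ) + 1 ≤ h := by exact_mod_cast hc
  have hc1' : (c' : ℤ) + 1 ≤ h := by exact_mod_cast hc'
  have h0 : (0 : ℤ) ≤ c := by positivity
  have h0' : (0 : ℤ) ≤ c' := by positivity
  have hW : (0 : ℤ) ≤ W := by positivity
  have hlt : |((c' : ℤ) - c) * D + e| < L := by
    rw [abs_lt]
    constructor <;> nlinarith
  have hz := Int.eq_zero_of_abs_lt_dvd hdvd hlt
  rcases lt_or_gt_of_ne hne with hlt | hlt
  · have : (c : ℤ) + 1 ≤ c' := by exact_mod_cast hlt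
    nlinarith
  · have : (c' : ℤ) + 1 ≤ c := by exact_mod_cast hlt
    nlinarith

variable {G : SimpleGraph V} {π : V → T} {φ : ℤ × ℤ →+ T} {r R L M : ℕ}

lemma disjoint_edgesOver_colStrip (hG : ∀ u v, G.Adj u v ↔ π v - π u ∈ (boxOffsets r).image φ)
    (hφ : ∀ d, φ d = 0 ↔ (L : ℤ) ∣ d.1 ∧ (M : ℤ) ∣ d.2) {x x' : ℤ}
    (h : ∀ e : ℤ, |e| ≤ (2 * R + r : ℕ) → ¬ (L : ℤ) ∣ x' - x + e) :
    Disjoint (edgesOver G π (colStrip φ R x)) (edgesOver G π (colStrip φ R x')) := by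
  refine disjoint_edgesOver hG ?_
  rintro _ ⟨b, y, hb, rfl⟩ _ ⟨b', y', hb', rfl⟩
  rw [abs_le] at hb hb'
  constructor
  · rw [← sub_ne_zero, ← map_sub, Ne, hφ]
    rintro ⟨h1, -⟩
    refine h (b' - b) (abs_le.2 ⟨?_, ?_⟩) (by convert h1 using 1; simp only [Prod.fst_sub]; ring)
    all_goals push_cast; linarith
  · rw [Finset.mem_image]
    rintro ⟨o, ho, heq⟩
    rw [eq_comm, ← map_sub, ← sub_eq_zero, ← map_sub, hφ] at heq
    obtain ⟨-, ho1, -⟩ := mem_boxOffsets.1 ho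
    refine h (b' - b - o.1) (abs_le.2 ⟨?_, ?_⟩)
      (by convert heq.1 using 1; simp only [Prod.fst_sub]; ring)
    all_goals push_cast; linarith

lemma disjoint_edgesOver_rowStrip (hG : ∀ u v, G.Adj u v ↔ π v - π u ∈ (boxOffsets r).image φ)
    (hφ : ∀ d, φ d = 0 ↔ (L : ℤ) ∣ d.1 ∧ (M : ℤ) ∣ d.2) {y y' : ℤ}
    (h : ∀ e : ℤ, |e| ≤ (2 * R + r : ℕ) → ¬ (M : ℤ) ∣ y' - y + e) :
    Disjoint (edgesOver G π (rowStrip φ R y)) (edgesOver G π (rowStrip φ R y')) := by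
  refine disjoint_edgesOver hG ?_
  rintro _ ⟨b, x, hb, rfl⟩ _ ⟨b', x', hb', rfl⟩
  rw [abs_le] at hb hb'
  constructor
  · rw [← sub_ne_zero, ← map_sub, Ne, hφ]
    rintro ⟨-, h1⟩
    refine h (b' - b) (abs_le.2 ⟨?_, ?_⟩) (by convert h1 using 1; simp only [Prod.snd_sub]; ring)
    all_goals push_cast; linarith
  · rw [Finset.mem_image]
    rintro ⟨o, ho, heq⟩
    rw [eq_comm, ← map_sub, ← sub_eq_zero, ← map_sub, hφ] at heq
    obtain ⟨-, -, ho1⟩ := mem_boxOffsets.1 ho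
    refine h (b' - b - o.2) (abs_le.2 ⟨?_, ?_⟩)
      (by convert heq.2 using 1; simp only [Prod.snd_sub]; ring)
    all_goals push_cast; linarith

variable {bad : T → Finset (Sym2 V) → Prop} {p : ℝ}

lemma detBy_siteGood (hdet : ∀ t, DetBy (bad t) (edgesOver G π {t})) (t : T) :
    DetBy (SiteGood bad φ R t) (edgesOver G π (drop φ R t)) :=
  DetBy.all fun s => DetBy.all fun hs =>
    ((hdet s).mono (edgesOver_mono (by simpa using hs))).not

lemma detBy_colGood (hdet : ∀ t, DetBy (bad t) (edgesOver G π {t})) (x : ℤ) :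
    DetBy (ColGood bad φ R x) (edgesOver G π (colStrip φ R x)) :=
  DetBy.all fun y => (detBy_siteGood hdet _).mono (edgesOver_mono (drop_subset_colStrip φ R x y))

lemma detBy_seed (t : T) : DetBy (Seed G π φ R t) (edgesOver G π (drop φ R t)) := by
  intro s s' h
  refine forall_congr' fun e => ?_
  by_cases he : e ∈ edgesOver G π (drop φ R t)
  · simp [he, h e he]
  · simp [he]

lemma unifProb_not_siteGood_le {E : Finset (Sym2 V)} (hp : ∀ t, unifProb E (bad t) ≤ p)
    (t : T) : unifProb E (fun ω => ¬ SiteGood bad φ R t ω) ≤ (discPoints R).card * p := by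
  have h0 : 0 ≤ p := unifProb.nonneg.trans (hp t)
  calc unifProb E (fun ω => ¬ SiteGood bad φ R t ω)
      ≤ unifProb E (fun ω => ∃ s ∈ drop φ R t, bad s ω) :=
        unifProb.mono fun ω _ h => by simpa [SiteGood] using h
    _ ≤ (drop φ R t).card * p := unifProb.exists_le_card_mul _ _ _ fun s _ => hp s
    _ ≤ (discPoints R).card * p := by
        gcongr
        exact card_drop_le φ R t

lemma unifProb_not_forall_siteGood_le {E : Finset (Sym2 V)} (hp : ∀ t, unifProb E (bad t) ≤ p)
    (l : ℕ) (t : ℕ → T) :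
    unifProb E (fun ω => ¬ ∀ d ∈ Finset.range l, SiteGood bad φ R (t d) ω) ≤
      l * ((discPoints R).card * p) := by
  have := unifProb.exists_le_card_mul (E := E) (Finset.range l)
    (fun d ω => ¬ SiteGood bad φ R (t d) ω) _ fun d _ => unifProb_not_siteGood_le hp (t d)
  rw [Finset.card_range] at this
  refine le_trans (unifProb.mono fun ω _ h => ?_) this
  simpa using h

lemma colGood_iff (hM : 0 < M) (hφ : φ (0, (M : ℤ)) = 0) (x : ℤ) (ω : Finset (Sym2 V)) :
    ColGood bad φ R x ω ↔ ∀ d ∈ Finset.range M, SiteGood bad φ R (φ (x, (d : ℤ))) ω := by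
  refine ⟨fun h d _ => h d, fun h y => ?_⟩
  have hM' : (M : ℤ) ≠ 0 := by positivity
  have h1 := h (y % M).toNat (by
    rw [Finset.mem_range]
    zify
    rw [Int.toNat_of_nonneg (Int.emod_nonneg _ hM')]
    exact Int.emod_lt_of_pos _ (by positivity))
  rw [Int.toNat_of_nonneg (Int.emod_nonneg _ hM')] at h1
  have h2 : ((x, y) : ℤ × ℤ) = (x, y % M) + (y / M) • (0, (M : ℤ)) := by
    ext
    · simp
    · simp [Int.emod_add_ediv_mul]
  rwa [h2, map_add, map_zsmul, hφ, smul_zero, add_zero]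

lemma unifProb_not_colGood_le {E : Finset (Sym2 V)} (hM : 0 < M) (hφ : φ (0, (M : ℤ)) = 0)
    (hp : ∀ t, unifProb E (bad t) ≤ p) (x : ℤ) :
    unifProb E (fun ω => ¬ ColGood bad φ R x ω) ≤ M * ((discPoints R).card * p) := by
  simp only [colGood_iff hM hφ]
  exact unifProb_not_forall_siteGood_le hp M _

variable {D h J : ℕ}

lemma unifProb_no_good_column_le
    (hG : ∀ u v, G.Adj u v ↔ π v - π u ∈ (boxOffsets r).image φ)
    (hφ : ∀ d, φ d = 0 ↔ (L : ℤ) ∣ d.1 ∧ (M : ℤ) ∣ d.2)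
    (hdet : ∀ t, DetBy (bad t) (edgesOver G π {t})) {E : Finset (Sym2 V)} {x : ℝ}
    (hcol : ∀ z, unifProb E (fun ω => ¬ ColGood bad φ R z ω) ≤ x)
    (hRD : 2 * R + r < D) (hL : h * D ≤ L) (z : ℤ) :
    unifProb E (fun ω => ∀ c ∈ Finset.range h, ¬ ColGood bad φ R (z + c * D) ω) ≤ x ^ h := by
  have key := unifProb.forall_le_pow (E := E) (Finset.range h)
    (fun c ω => ¬ ColGood bad φ R (z + c * D) ω)
    (fun c => edgesOver G π (colStrip φ R (z + c * D))) (fun c _ => (detBy_colGood hdet _).not)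
    ?_ x fun c _ => hcol _
  · rwa [Finset.card_range] at key
  · intro i hi j hj hij
    refine disjoint_edgesOver_colStrip hG hφ fun e he => ?_
    have := not_dvd_of_spacing hRD hL (Finset.mem_range.1 hi) (Finset.mem_range.1 hj) hij he
    convert this using 2
    ring

lemma unifProb_no_good_row_le
    (hG : ∀ u v, G.Adj u v ↔ π v - π u ∈ (boxOffsets r).image φ)
    (hφ : ∀ d, φ d = 0 ↔ (L : ℤ) ∣ d.1 ∧ (M : ℤ) ∣ d.2)
    (hdet : ∀ t, DetBy (bad t) (edgesOver G π {t})) {E : Finset (Sym2 V)}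
    (hp : ∀ t, unifProb E (bad t) ≤ p)
    (hRD : 2 * R + r < D) (hM : h * D ≤ M) (z : ℤ) (l : ℕ) :
    unifProb E (fun ω => ∀ c ∈ Finset.range h,
      ¬ ∀ d ∈ Finset.range l, SiteGood bad φ R (φ (z + d, c * D)) ω) ≤
        (l * ((discPoints R).card * p)) ^ h := by
  have key := unifProb.forall_le_pow (E := E) (Finset.range h)
    (fun c ω => ¬ ∀ d ∈ Finset.range l, SiteGood bad φ R (φ (z + d, c * D)) ω)
    (fun c => edgesOver G π (rowStrip φ R (c * D)))
    (fun c _ => (DetBy.all fun d => DetBy.all fun _ => (detBy_siteGood hdet _).mono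
      (edgesOver_mono (drop_subset_rowStrip φ R _ _))).not)
    ?_ _ fun c _ => unifProb_not_forall_siteGood_le hp l _
  · rwa [Finset.card_range] at key
  · intro i hi j hj hij
    refine disjoint_edgesOver_rowStrip hG hφ fun e he => ?_
    have := not_dvd_of_spacing hRD hM (Finset.mem_range.1 hi) (Finset.mem_range.1 hj) hij he
    convert this using 2
    ring

variable [Fintype V]

lemma le_unifProb_seed_and_colGood {k m : ℕ} (hreg : G.IsRegularOfDegree k)
    (hm : ∀ t, (cluster π t).card = m)
    (hmono : ∀ t ω ω', ω ⊆ ω' → bad t ω → bad t ω') {x : ℤ}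
    (hcol : unifProb G.edgeSet.toFinset (fun ω => ¬ ColGood bad φ R x ω) ≤ 1 / 2) (t : T) :
    (1 / 2) ^ ((discPoints R).card * m * k + 1) ≤
      unifProb G.edgeSet.toFinset (fun ω => Seed G π φ R t ω ∧ ColGood bad φ R x ω) := by
  set X := edgesOver G π (drop φ R t)
  have hdet : DetBy (fun ω : Finset (Sym2 V) => ColGood bad φ R x (ω.filter (· ∉ X))) Xᶜ := by
    intro s s' h
    have : s.filter (· ∉ X) = s'.filter (· ∉ X) := by
      ext e
      simp only [Finset.mem_filter, and_congr_left_iff]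
      exact h e
    simp only [this]
  have hcol' : 1 / 2 ≤ unifProb G.edgeSet.toFinset
      (fun ω => ColGood bad φ R x (ω.filter (· ∉ X))) := by
    refine le_trans ?_ (unifProb.mono (A := ColGood bad φ R x) fun ω _ h y s hs hbad =>
      h y s hs (hmono _ _ _ (Finset.filter_subset _ _) hbad))
    linarith [unifProb.add_compl (E := G.edgeSet.toFinset) (A := ColGood bad φ R x)]
  rw [unifProb.congr (B := fun ω => Seed G π φ R t ω ∧ ColGood bad φ R x (ω.filter (· ∉ X))),
    unifProb.and_eq_mul (detBy_seed t) hdet, pow_succ]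
  · have h1 : unifProb G.edgeSet.toFinset (Seed G π φ R t) =
        (1 / 2) ^ (G.edgeSet.toFinset.filter (· ∈ X)).card := unifProb.avoid_eq X
    rw [h1]
    refine mul_le_mul (pow_le_pow_of_le_one (by norm_num) (by norm_num) ?_) hcol'
      (by norm_num) (by positivity)
    refine (card_edgesOver_le hreg hm _).trans ?_
    gcongr
    exact card_drop_le φ R t
  · intro ω _
    refine and_congr_right fun h => ?_
    rw [Finset.filter_true_of_mem h]

lemma unifProb_no_seed_le {k m : ℕ} (hreg : G.IsRegularOfDegree k)
    (hm : ∀ t, (cluster π t).card = m)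
    (hG : ∀ u v, G.Adj u v ↔ π v - π u ∈ (boxOffsets r).image φ)
    (hφ : ∀ d, φ d = 0 ↔ (L : ℤ) ∣ d.1 ∧ (M : ℤ) ∣ d.2)
    (hdet : ∀ t, DetBy (bad t) (edgesOver G π {t}))
    (hmono : ∀ t ω ω', ω ⊆ ω' → bad t ω → bad t ω')
    (hcol : ∀ x, unifProb G.edgeSet.toFinset (fun ω => ¬ ColGood bad φ R x ω) ≤ 1 / 2)
    (hRM : 2 * R + r < M) (hJ : J * M ≤ L) (x₀ : ℤ) :
    unifProb G.edgeSet.toFinset (fun ω => ∀ i ∈ Finset.range J,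
        ¬ (Seed G π φ R (φ (x₀ - (J - i) * M, 0)) ω ∧
          ColGood bad φ R (x₀ - (J - i) * M) ω)) ≤
      (1 - (1 / 2) ^ ((discPoints R).card * m * k + 1)) ^ J := by
  have key := unifProb.forall_le_pow (E := G.edgeSet.toFinset) (Finset.range J)
    (fun (i : ℕ) ω => ¬ (Seed G π φ R (φ (x₀ - (J - i) * M, 0)) ω ∧
      ColGood bad φ R (x₀ - (J - i) * M) ω))
    (fun i => edgesOver G π (colStrip φ R (x₀ - (J - i) * M))) ?_ ?_
    (1 - (1 / 2) ^ ((discPoints R).card * m * k + 1)) ?_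
  · rwa [Finset.card_range] at key
  · exact fun i _ => (((detBy_seed _).mono
      (edgesOver_mono (drop_subset_colStrip φ R _ 0))).and (detBy_colGood hdet _)).not
  · intro i hi j hj hij
    refine disjoint_edgesOver_colStrip hG hφ fun e he => ?_
    have := not_dvd_of_spacing hRM hJ (Finset.mem_range.1 hi) (Finset.mem_range.1 hj) hij he
    convert this using 2
    ring
  · intro i _
    have := le_unifProb_seed_and_colGood hreg hm hmono (hcol (x₀ - (J - i) * M))
      (φ (x₀ - (J - i) * M, 0))
    linarith [unifProb.add_compl (E := G.edgeSet.toFinset) (A := fun ω =>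
      Seed G π φ R (φ (x₀ - (J - i) * M, 0)) ω ∧ ColGood bad φ R (x₀ - (J - i) * M) ω)]

lemma unifProb_not_nice_le {k m : ℕ} (hreg : G.IsRegularOfDegree k)
    (hm : ∀ t, (cluster π t).card = m)
    (hG : ∀ u v, G.Adj u v ↔ π v - π u ∈ (boxOffsets r).image φ)
    (hφ : ∀ d, φ d = 0 ↔ (L : ℤ) ∣ d.1 ∧ ((h * D : ℕ) : ℤ) ∣ d.2)
    (hdet : ∀ t, DetBy (bad t) (edgesOver G π {t}))
    (hmono : ∀ t ω ω', ω ⊆ ω' → bad t ω → bad t ω')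
    (hp : ∀ t, unifProb G.edgeSet.toFinset (bad t) ≤ p)
    (hRD : 2 * R + r < D) (hh : 0 < h) (hJ₀ : 0 < J) (hJ : J * (h * D) ≤ L)
    (hp₁ : 2 * (h * D) * ((discPoints R).card * p) ≤ 1 / 2) (x₀ : ℤ) :
    unifProb G.edgeSet.toFinset (fun ω => ¬ Nice G bad π φ R D h J x₀ ω) ≤
      2 * (h * D) * ((discPoints R).card * p) +
        (1 - (1 / 2) ^ ((discPoints R).card * m * k + 1)) ^ J +
        2 * J * (2 * (h * D) * ((discPoints R).card * p)) ^ h := by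
  set E := G.edgeSet.toFinset
  have hM : 0 < h * D := Nat.mul_pos hh (by omega)
  have hDM : D ≤ h * D := Nat.le_mul_of_pos_left D hh
  have hML : h * D ≤ L := (Nat.le_mul_of_pos_left _ hJ₀).trans hJ
  have hp0 : 0 ≤ p := unifProb.nonneg.trans (hp 0)
  have hcol : ∀ x, unifProb E (fun ω => ¬ ColGood bad φ R x ω) ≤
      2 * (h * D) * ((discPoints R).card * p) := by
    intro x
    refine (unifProb_not_colGood_le hM ((hφ _).2 (by simp)) hp x).trans ?_
    push_cast
    refine mul_le_mul_of_nonneg_right ?_ (by positivity)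
    have : (0 : ℝ) ≤ (h : ℝ) * D := by positivity
    linarith
  have h2 := unifProb_no_seed_le hreg hm hG hφ hdet hmono (fun x => (hcol x).trans hp₁)
    (hRD.trans_le hDM) hJ x₀
  have h3 := unifProb.exists_le_card_mul (E := E) (Finset.range J) (fun (i : ℕ) ω =>
      ∀ c ∈ Finset.range h, ¬ ∀ d ∈ Finset.range (2 * (h * D)),
        SiteGood bad φ R (φ (x₀ - (J - i) * (h * D) + d, c * D)) ω) _
    fun i _ => unifProb_no_good_row_le hG hφ hdet hp hRD le_rfl (x₀ - (J - i) * (h * D))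
      (2 * (h * D))
  have h4 := unifProb.exists_le_card_mul (E := E) (Finset.range J) (fun (i : ℕ) ω =>
      ∀ c ∈ Finset.range h, ¬ ColGood bad φ R (x₀ - (J - i) * (h * D) + c * D) ω) _
    fun i _ => unifProb_no_good_column_le hG hφ hdet hcol hRD hML (x₀ - (J - i) * (h * D))
  rw [Finset.card_range] at h3 h4
  push_cast at h2 h3
  have hsplit : unifProb E (fun ω => ¬ Nice G bad π φ R D h J x₀ ω) ≤ _ :=
    (unifProb.mono (B := fun ω => ¬ ColGood bad φ R x₀ ω ∨
      (∀ i ∈ Finset.range J, ¬ (Seed G π φ R (φ (x₀ - (J - i) * (h * D), 0)) ω ∧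
          ColGood bad φ R (x₀ - (J - i) * (h * D)) ω)) ∨
      (∃ i ∈ Finset.range J, ∀ c ∈ Finset.range h, ¬ ∀ d ∈ Finset.range (2 * (h * D)),
        SiteGood bad φ R (φ (x₀ - (J - i) * (h * D) + d, c * D)) ω) ∨
      ∃ i ∈ Finset.range J, ∀ c ∈ Finset.range h,
        ¬ ColGood bad φ R (x₀ - (J - i) * (h * D) + c * D) ω) fun ω _ hn => by
          by_contra hcon
          push Not at hcon
          exact hn hcon).trans <|
    unifProb.or_le.trans <| add_le_add_right (unifProb.or_le.trans <|
      add_le_add_right unifProb.or_le _) _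
  refine hsplit.trans ?_
  linarith [hcol x₀]

/-- A vertex lies in a subgraph of large minimum degree only if some site next to it fails to be
nice. -/
lemma unifProb_mem_core_le {q k m : ℕ} {a θ θ₀ : ℝ} (hreg : G.IsRegularOfDegree k)
    (hm : ∀ t, (cluster π t).card = m)
    (hG : ∀ u v, G.Adj u v ↔ π v - π u ∈ (boxOffsets r).image φ)
    (hN : ((boxOffsets r).image φ).card = (boxOffsets r).card)
    (hφ : ∀ d, φ d = 0 ↔ (L : ℤ) ∣ d.1 ∧ ((h * D : ℕ) : ℤ) ∣ d.2)
    (hsurj : Function.Surjective φ)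
    (hp : ∀ t, unifProb G.edgeSet.toFinset (Overloaded π ((boxOffsets r).image φ) a θ q t) ≤ p)
    (hθ : θ + (boxOffsets r).card * q ≤ θ₀) (hθ₀ : (boxOffsets r).card * q < θ₀) (hq : 0 < q)
    (hr : 2 ≤ r * a) (hR : r ^ 2 < R)
    (hRD : 2 * R + r < D) (hh : 0 < h) (hJ₀ : 0 < J) (hJ : J * (h * D) ≤ L)
    (hp₁ : 2 * (h * D) * ((discPoints R).card * p) ≤ 1 / 2) (v : V) :
    unifProb G.edgeSet.toFinset (fun ω => ∃ H, MinDegreeGE ω θ₀ H ∧ v ∈ H) ≤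
      (boxOffsets r).card * (2 * (h * D) * ((discPoints R).card * p) +
        (1 - (1 / 2) ^ ((discPoints R).card * m * k + 1)) ^ J +
        2 * J * (2 * (h * D) * ((discPoints R).card * p)) ^ h) := by
  choose c hc using hsurj
  have key := unifProb.exists_le_card_mul (E := G.edgeSet.toFinset) ((boxOffsets r).image φ)
    (fun n ω => ¬ Nice G (Overloaded π ((boxOffsets r).image φ) a θ q) π φ R D h J
      (c (π v + n)).1 ω) _
    fun n _ => unifProb_not_nice_le hreg hm hG hφ (fun t => Overloaded.detBy hG)
      (fun t ω ω' h => Overloaded.mono h) hp hRD hh hJ₀ hJ hp₁ _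
  rw [hN] at key
  refine le_trans (unifProb.mono fun ω hω hH => ?_) key
  obtain ⟨H, hH, hv⟩ := hH
  by_contra hcon
  push Not at hcon
  refine notMem_of_neighbours_depleted hG hω hH (by rwa [hN]) (fun n hn => ?_) hv
  have := (hcon n hn).depleted hG hN hω hH hθ (lt_of_le_of_lt (by positivity) hθ₀) hq hr hR
    (Nat.mul_pos hh (by omega)) ((hφ _).2 (by simp)) (c (π v + n)).2
  rwa [Prod.mk.eta, hc] at this

end Probability

section Asymptotics

open Filter

lemma tendsto_sq_mul_sub_atTop {c : ℝ} (hc : 0 < c) (A B : ℝ) :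
    Tendsto (fun k : ℝ => c * k ^ 2 - (A * k + B)) atTop atTop := by
  have h1 : Tendsto (fun k : ℝ => k * (c * k - A)) atTop atTop :=
    tendsto_id.atTop_mul_atTop₀
      (tendsto_atTop_add_const_right _ (-A) (tendsto_id.const_mul_atTop hc))
  refine (tendsto_atTop_add_const_right _ (-B) h1).congr fun k => ?_
  ring

lemma two_le_exp_one : (2 : ℝ) ≤ Real.exp 1 := by
  linarith [Real.add_one_le_exp (1 : ℝ)]

lemma two_pow_le_exp (n : ℕ) : (2 : ℝ) ^ n ≤ Real.exp n := by
  rw [← mul_one (n : ℝ), Real.exp_nat_mul]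
  exact pow_le_pow_left₀ (by norm_num) two_le_exp_one n

lemma one_sub_pow_le_exp {δ : ℝ} (hδ : δ ≤ 1) (J : ℕ) : (1 - δ) ^ J ≤ Real.exp (-(J * δ)) := by
  rw [← mul_neg, Real.exp_nat_mul]
  refine pow_le_pow_left₀ (by linarith) ?_ J
  linarith [Real.add_one_le_exp (-δ)]

/-- The error terms in the union bound decay faster than any constant multiple of
`exp (-c * k ^ 2)`, for a suitable height `h` and rate `c`. -/
lemma exists_eventually_error_le {a : ℝ} (ha : 0 < a) {K d g D : ℕ} (hK : 0 < K) (hg : 0 < g) :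
    ∃ h : ℕ, 0 < h ∧ ∃ c : ℝ, 0 < c ∧ ∀ ε : ℝ, 0 < ε → ∀ᶠ q : ℕ in atTop, ∃ J : ℕ, 0 < J ∧
      ∀ p : ℝ, p = 2 ^ K * (2 ^ (g * q) *
        Real.exp (-(a ^ 2 * (q * ((g * q : ℕ) * K)) / 8))) →
      2 * (h * D) * (d * p) ≤ 1 / 2 ∧
      K * (2 * (h * D) * (d * p) +
        (1 - (1 / 2) ^ (d * (g * q) * (g * q * K) + 1)) ^ J +
        2 * J * (2 * (h * D) * (d * p)) ^ h) ≤ ε * Real.exp (-c) ^ ((g * q * K) ^ 2) := by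
  set c₀ : ℝ := a ^ 2 / (8 * g * K) with hc₀
  have hc₀pos : 0 < c₀ := by positivity
  obtain ⟨h, hh⟩ := exists_nat_gt ((d + 4) / (c₀ / 2))
  have hh' : d + 4 ≤ h * (c₀ / 2) := ((div_lt_iff₀ (by positivity)).1 hh).le
  have hhpos : 0 < h := by
    rw [← Nat.cast_pos (α := ℝ)]
    exact lt_of_le_of_lt (by positivity) hh
  set c₁ : ℝ := min (c₀ / 2) 1 with hc₁
  have hc₁pos : 0 < c₁ := lt_min (by positivity) one_pos
  refine ⟨h, hhpos, c₁ / 2, by positivity, fun ε hε => ?_⟩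
  have hk : Tendsto (fun q : ℕ => ((g * q * K : ℕ) : ℝ)) atTop atTop := by
    refine tendsto_natCast_atTop_atTop.comp ?_
    refine tendsto_atTop_mono (fun q => ?_) tendsto_id
    exact (Nat.le_mul_of_pos_left q hg).trans (Nat.le_mul_of_pos_right _ hK)
  have e1 := ((tendsto_sq_mul_sub_atTop (half_pos hc₀pos) 1 (2 * (h * D) * d + K)).comp
    hk).eventually_ge_atTop 0
  have e2 := ((tendsto_sq_mul_sub_atTop (half_pos hc₁pos) 0 (3 * K / ε)).comp
    hk).eventually_ge_atTop 0
  have e3 := ((tendsto_sq_mul_sub_atTop (half_pos hc₀pos) 0 1).comp hk).eventually_ge_atTop 0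
  filter_upwards [e1, e2, e3, hk.eventually_ge_atTop 1] with q h1 h2 h3 hk1
  simp only [Function.comp] at h1 h2 h3
  obtain ⟨k, hkdef⟩ : ∃ k : ℕ, k = g * q * K := ⟨_, rfl⟩
  rw [← hkdef] at h1 h2 h3 hk1 ⊢
  have hkpos : 0 < k := by exact_mod_cast hk1
  have hmk : g * q ≤ k := hkdef ▸ Nat.le_mul_of_pos_right _ hK
  obtain ⟨s, hs⟩ : ∃ s, s = d * (g * q) * k + 1 := ⟨_, rfl⟩
  have hs' : (s : ℝ) ≤ d * (k : ℝ) ^ 2 + 1 := by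
    rw [hs]
    push_cast
    have : ((g * q : ℕ) : ℝ) ≤ k := by exact_mod_cast hmk
    push_cast at this
    have : (d : ℝ) * (g * q) * k ≤ d * k * k := by gcongr
    linarith
  rw [← hs]
  refine ⟨2 ^ s * k ^ 2, by positivity, fun p hp => ?_⟩
  have hp0 : 0 ≤ p := hp ▸ by positivity
  have hk2 : (1 : ℝ) ≤ (k : ℝ) ^ 2 := one_le_pow₀ hk1
  obtain ⟨p₁, hp₁def⟩ : ∃ p₁ : ℝ, p₁ = 2 * (h * D) * (d * p) := ⟨_, rfl⟩
  rw [← hp₁def]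
  have hp₁0 : 0 ≤ p₁ := hp₁def ▸ by positivity
  have hp₁ : p₁ ≤ Real.exp (-(c₀ / 2 * (k : ℝ) ^ 2)) := by
    have hexp : -(a ^ 2 * (q * ((g * q : ℕ) * K)) / 8) = -(c₀ * (k : ℝ) ^ 2) := by
      rw [hc₀, hkdef]
      push_cast
      field_simp
    rw [hp₁def, hp, hexp]
    calc 2 * (h * D) * (d * (2 ^ K * (2 ^ (g * q) * Real.exp (-(c₀ * (k : ℝ) ^ 2)))))
        = 2 * (h * D) * d * 2 ^ K * 2 ^ (g * q) * Real.exp (-(c₀ * (k : ℝ) ^ 2)) := by ring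
      _ ≤ Real.exp (2 * (h * D) * d) * Real.exp K * Real.exp k *
          Real.exp (-(c₀ * (k : ℝ) ^ 2)) := by
        gcongr
        · linarith [Real.add_one_le_exp (2 * (h * D) * d : ℝ)]
        · exact two_pow_le_exp K
        · exact (pow_le_pow_right₀ (by norm_num) hmk).trans (two_pow_le_exp k)
      _ ≤ Real.exp (-(c₀ / 2 * (k : ℝ) ^ 2)) := by
        rw [← Real.exp_add, ← Real.exp_add, ← Real.exp_add]
        refine Real.exp_le_exp.2 ?_
        linarith
  have hseed : (1 - (1 / 2) ^ s : ℝ) ^ (2 ^ s * k ^ 2) ≤ Real.exp (-(c₁ * (k : ℝ) ^ 2)) := by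
    refine (one_sub_pow_le_exp (pow_le_one₀ (by norm_num) (by norm_num)) _).trans
      (Real.exp_le_exp.2 ?_)
    have : ((2 ^ s * k ^ 2 : ℕ) : ℝ) * (1 / 2) ^ s = (k : ℝ) ^ 2 := by
      push_cast
      rw [mul_right_comm, ← mul_pow]
      norm_num
    rw [this]
    have := mul_le_mul_of_nonneg_right (min_le_right (c₀ / 2) 1) (sq_nonneg (k : ℝ))
    linarith
  have hstrip : 2 * ((2 ^ s * k ^ 2 : ℕ) : ℝ) * p₁ ^ h ≤ Real.exp (-(c₁ * (k : ℝ) ^ 2)) := by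
    have hb : p₁ ^ h ≤ Real.exp (-((d + 4) * (k : ℝ) ^ 2)) := by
      refine (pow_le_pow_left₀ hp₁0 hp₁ h).trans ?_
      rw [← Real.exp_nat_mul]
      refine Real.exp_le_exp.2 ?_
      have := mul_le_mul_of_nonneg_right hh' (sq_nonneg (k : ℝ))
      linarith
    have hpow : (k : ℝ) ^ 2 ≤ Real.exp ((k : ℝ) ^ 2) := by
      linarith [Real.add_one_le_exp ((k : ℝ) ^ 2)]
    push_cast
    calc 2 * (2 ^ s * (k : ℝ) ^ 2) * p₁ ^ h
        ≤ Real.exp 1 * (Real.exp s * Real.exp ((k : ℝ) ^ 2)) *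
          Real.exp (-((d + 4) * (k : ℝ) ^ 2)) := by
          gcongr
          · exact two_le_exp_one
          · exact two_pow_le_exp s
      _ ≤ Real.exp (-(c₁ * (k : ℝ) ^ 2)) := by
          rw [← Real.exp_add, ← Real.exp_add, ← Real.exp_add]
          refine Real.exp_le_exp.2 ?_
          have := mul_le_mul_of_nonneg_right (min_le_right (c₀ / 2) 1) (sq_nonneg (k : ℝ))
          linarith
  have hp₁' : p₁ ≤ Real.exp (-(c₁ * (k : ℝ) ^ 2)) := by
    refine hp₁.trans (Real.exp_le_exp.2 ?_)
    have := mul_le_mul_of_nonneg_right (min_le_left (c₀ / 2) 1) (sq_nonneg (k : ℝ))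
    linarith
  constructor
  · refine hp₁.trans ?_
    have h3' : (2 : ℝ) ≤ Real.exp (c₀ / 2 * (k : ℝ) ^ 2) :=
      two_le_exp_one.trans (Real.exp_le_exp.2 (by linarith))
    rw [Real.exp_neg, one_div]
    gcongr
  · have hε' : 3 * K ≤ ε * Real.exp (c₁ / 2 * (k : ℝ) ^ 2) := by
      rw [← div_le_iff₀' hε]
      linarith [Real.add_one_le_exp (c₁ / 2 * (k : ℝ) ^ 2)]
    calc (K : ℝ) * (p₁ + (1 - (1 / 2) ^ s) ^ (2 ^ s * k ^ 2) +
          2 * ((2 ^ s * k ^ 2 : ℕ) : ℝ) * p₁ ^ h)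
        ≤ K * (Real.exp (-(c₁ * (k : ℝ) ^ 2)) + Real.exp (-(c₁ * (k : ℝ) ^ 2)) +
          Real.exp (-(c₁ * (k : ℝ) ^ 2))) := by gcongr
      _ = 3 * K * Real.exp (-(c₁ * (k : ℝ) ^ 2)) := by ring
      _ ≤ ε * Real.exp (c₁ / 2 * (k : ℝ) ^ 2) * Real.exp (-(c₁ * (k : ℝ) ^ 2)) := by gcongr
      _ = ε * Real.exp (-(c₁ / 2)) ^ (k ^ 2) := by
        rw [mul_assoc, ← Real.exp_add, ← Real.exp_nat_mul]
        congr 2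
        push_cast
        ring

end Asymptotics

section Conclusion

/-- Markov's inequality for the number of events that occur. -/
lemma unifProb.mul_card_filter_lt_le {ι κ : Type*} [Fintype κ] {E : Finset ι}
    (A : κ → Finset ι → Prop) (x : ℝ) :
    unifProb E (fun s => x < ((Finset.univ.filter (fun i => A i s)).card : ℝ)) * x ≤
      ∑ i, unifProb E (A i) := by
  simp only [unifProb.eq_div]
  rw [← Finset.sum_div, div_mul_eq_mul_div]
  gcongr ?_ / _
  have hswap : ∑ i, ((E.powerset.filter (A i)).card : ℝ) =
      ∑ s ∈ E.powerset, ((Finset.univ.filter (fun i => A i s)).card : ℝ) := by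
    simp only [Finset.card_filter]
    push_cast
    exact Finset.sum_comm
  rw [hswap, Finset.card_filter]
  push_cast
  rw [Finset.sum_mul]
  refine Finset.sum_le_sum fun s _ => ?_
  split_ifs with h
  · rw [one_mul]
    exact h.le
  · rw [zero_mul]
    positivity

lemma subgraphProb_half {V : Type} [Fintype V] (G : SimpleGraph V) (A : SimpleGraph V → Prop) :
    subgraphProb G (1 / 2) A =
      unifProb G.edgeSet.toFinset (fun s => A (SimpleGraph.fromEdgeSet ↑s)) := by
  rw [subgraphProb, unifProb.eq_div, Finset.card_filter]
  push_cast
  rw [Finset.sum_div]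
  refine Finset.sum_congr rfl fun s hs => ?_
  split_ifs
  · have : (1 - 1 / 2 : ℝ) = 1 / 2 := by norm_num
    rw [this, ← pow_add, Nat.add_sub_cancel' (Finset.card_le_card (Finset.mem_powerset.1 hs)),
      one_div, inv_pow, one_div]
  · simp

lemma one_sub_le_subgraphProb_half {V : Type} [Fintype V] {G : SimpleGraph V} {θ₀ η x ε : ℝ}
    (hx : 0 < x) (hη : η ≤ ε * x)
    (hcore : ∀ v, unifProb G.edgeSet.toFinset (fun ω => ∃ H, MinDegreeGE ω θ₀ H ∧ v ∈ H) ≤ η)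
    (hV : 0 < Fintype.card V) :
    1 - ε ≤ subgraphProb G (1 / 2) (fun G' => ∀ s : Finset V,
      (∀ v ∈ s, θ₀ ≤ ((s.filter (fun u => G'.Adj v u)).card : ℝ)) →
        (s.card : ℝ) ≤ x * Fintype.card V) := by
  have hV' : (0 : ℝ) < Fintype.card V := by exact_mod_cast hV
  obtain ⟨A, hA⟩ : ∃ A : V → Finset (Sym2 V) → Prop,
      A = fun v ω => ∃ H, MinDegreeGE ω θ₀ H ∧ v ∈ H := ⟨_, rfl⟩
  have hmarkov := unifProb.mul_card_filter_lt_le (E := G.edgeSet.toFinset) A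
    (x * Fintype.card V)
  have hsum : ∑ v, unifProb G.edgeSet.toFinset (A v) ≤ ε * (x * Fintype.card V) := by
    have hcore' : ∀ v, unifProb G.edgeSet.toFinset (A v) ≤ ε * x := by
      rw [hA]
      exact fun v => (hcore v).trans hη
    refine (Finset.sum_le_sum fun v _ => hcore' v).trans ?_
    rw [Finset.sum_const, Finset.card_univ, nsmul_eq_mul]
    linarith
  have hbad := le_of_mul_le_mul_right (hmarkov.trans hsum) (mul_pos hx hV')
  have hcompl := unifProb.add_compl (E := G.edgeSet.toFinset) (A := fun s =>
    x * Fintype.card V < ((Finset.univ.filter (fun v => A v s)).card : ℝ))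
  rw [subgraphProb_half]
  refine le_trans (by linarith) (unifProb.mono (A := fun s =>
    ¬ x * Fintype.card V < ((Finset.univ.filter (fun v => A v s)).card : ℝ)) ?_)
  intro ω _ hω s hs
  refine le_trans ?_ (not_lt.1 hω)
  refine Nat.cast_le.2 (Finset.card_le_card fun v hv => ?_)
  refine Finset.mem_filter.2 ⟨Finset.mem_univ v, hA ▸ ⟨s, fun u hu => (hs u hu).trans ?_, hv⟩⟩
  refine Nat.cast_le.2 (Finset.card_le_card fun w hw => ?_)
  simp only [Finset.mem_filter, SimpleGraph.fromEdgeSet_adj, Finset.mem_coe] at hw ⊢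
  exact ⟨hw.1, hw.2.1⟩

/-- The quotient map from the integer lattice to a discrete torus. -/
noncomputable def latticeToTorus (L M : ℕ) : ℤ × ℤ →+ ZMod L × ZMod M :=
  (Int.castAddHom (ZMod L)).prodMap (Int.castAddHom (ZMod M))

lemma latticeToTorus_eq_zero {L M : ℕ} (d : ℤ × ℤ) :
    latticeToTorus L M d = 0 ↔ (L : ℤ) ∣ d.1 ∧ (M : ℤ) ∣ d.2 := by
  simp [latticeToTorus, Prod.ext_iff, ZMod.intCast_zmod_eq_zero_iff_dvd]

lemma latticeToTorus_surjective (L M : ℕ) : Function.Surjective (latticeToTorus L M) :=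
  Prod.map_surjective.2 ⟨ZMod.intCast_surjective, ZMod.intCast_surjective⟩

lemma latticeToTorus_injOn {r L M : ℕ} (hL : 2 * r < L) (hM : 2 * r < M) :
    Set.InjOn (latticeToTorus L M) (insert 0 (boxOffsets r) : Finset (ℤ × ℤ)) := by
  have hbox : ∀ o ∈ insert 0 (boxOffsets r), (-(r : ℤ) ≤ o.1 ∧ o.1 ≤ r) ∧
      -(r : ℤ) ≤ o.2 ∧ o.2 ≤ r := by
    intro o ho
    rcases Finset.mem_insert.1 ho with rfl | ho
    · simp
    · exact (mem_boxOffsets.1 ho).2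
  intro o ho o' ho' h
  obtain ⟨h1, h2⟩ := hbox o ho
  obtain ⟨h1', h2'⟩ := hbox o' ho'
  rw [← sub_eq_zero, ← map_sub, latticeToTorus_eq_zero] at h
  have e1 := Int.eq_zero_of_abs_lt_dvd h.1 (by rw [Prod.fst_sub, abs_lt]; omega)
  have e2 := Int.eq_zero_of_abs_lt_dvd h.2 (by rw [Prod.snd_sub, abs_lt]; omega)
  exact Prod.ext (sub_eq_zero.1 e1) (sub_eq_zero.1 e2)

/-- The blow-up of the graph on a discrete torus joining points at sup-distance at most `r`. -/
lemma exists_blowUp {r L M m : ℕ} (hL : 2 * r < L) (hM : 2 * r < M) :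
    ∃ (T : Type) (_ : AddCommGroup T) (φ : ℤ × ℤ →+ T) (π : Fin (L * M * m) → T)
      (G : SimpleGraph (Fin (L * M * m))),
      (∀ d, φ d = 0 ↔ (L : ℤ) ∣ d.1 ∧ (M : ℤ) ∣ d.2) ∧ Function.Surjective φ ∧
      (∀ t, (cluster π t).card = m) ∧
      (∀ u v, G.Adj u v ↔ π v - π u ∈ (boxOffsets r).image φ) ∧
      ((boxOffsets r).image φ).card = (boxOffsets r).card := by
  have : NeZero L := ⟨by omega⟩
  have : NeZero M := ⟨by omega⟩
  have hinj := latticeToTorus_injOn hL hM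
  have hneg : ∀ t ∈ (boxOffsets r).image (latticeToTorus L M),
      -t ∈ (boxOffsets r).image (latticeToTorus L M) := by
    intro t ht
    obtain ⟨o, ho, rfl⟩ := Finset.mem_image.1 ht
    rw [← map_neg]
    refine Finset.mem_image_of_mem _ ?_
    rw [mem_boxOffsets] at ho ⊢
    simp only [Ne, neg_eq_zero, Prod.fst_neg, Prod.snd_neg]
    exact ⟨ho.1, by omega⟩
  have hzero : (0 : ZMod L × ZMod M) ∉ (boxOffsets r).image (latticeToTorus L M) := by
    intro h
    obtain ⟨o, ho, h0⟩ := Finset.mem_image.1 h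
    exact (mem_boxOffsets.1 ho).1 (hinj (by simp [ho]) (by simp) (h0.trans (map_zero _).symm))
  have hcard : Fintype.card (Fin (L * M * m)) = Fintype.card ((ZMod L × ZMod M) × Fin m) := by
    simp [ZMod.card]
  obtain ⟨e⟩ := Fintype.card_eq.1 hcard
  refine ⟨ZMod L × ZMod M, inferInstance, latticeToTorus L M, fun v => (e v).1,
    ⟨fun u v => (e v).1 - (e u).1 ∈ (boxOffsets r).image (latticeToTorus L M),
    ⟨fun u v h => by simpa using hneg _ h⟩, ⟨fun u h => hzero (by simpa using h)⟩⟩,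
    latticeToTorus_eq_zero, latticeToTorus_surjective L M, ?_, fun u v => by simp, ?_⟩
  swap
  · have : Set.InjOn (latticeToTorus L M) (boxOffsets r) :=
      hinj.mono (Finset.coe_subset.2 (Finset.subset_insert _ _))
    convert Finset.card_image_of_injOn this
  intro t
  have : cluster (fun v => (e v).1) t = Finset.univ.image (fun i => e.symm (t, i)) := by
    ext v
    simp only [mem_cluster, Finset.mem_image, Finset.mem_univ, true_and, e.symm_apply_eq]
    exact ⟨fun h => ⟨(e v).2, by rw [← h]⟩, fun ⟨i, h⟩ => by rw [← h]⟩
  rw [this, Finset.card_image_of_injective _ fun i j h => by simpa using h, Finset.card_univ,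
    Fintype.card_fin]

open Filter in
/-- The main theorem with `C = 1` and a genuine exponential decay rate `β < 1`. -/
theorem small_core_above_quarter_of_lt_one (α : ℝ) (hα : 0 < α) :
    ∃ β : ℝ, 0 < β ∧ β < 1 ∧ ∀ ε : ℝ, 0 < ε →
      {k : ℕ | 0 < k ∧ ∀ N : ℕ, ∃ n : ℕ, N ≤ n ∧
        ∃ G : SimpleGraph (Fin n), G.IsRegularOfDegree k ∧
          1 - ε ≤ subgraphProb G (1/2)
            (fun G' => ∀ s : Finset (Fin n),
              (∀ v ∈ s, (k : ℝ) / 4 + α * k ≤ ((s.filter (fun u => G'.Adj v u)).card : ℝ)) →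
              (s.card : ℝ) ≤ (1 - β) ^ (k ^ 2) * n)}.Infinite := by
  obtain ⟨r, hr⟩ := exists_nat_ge (2 / α)
  rw [div_le_iff₀ hα] at hr
  obtain ⟨g, hg⟩ := exists_nat_ge (4 / α)
  rw [div_le_iff₀ hα] at hg
  have hr0 : 0 < r := Nat.pos_of_ne_zero (by rintro rfl; norm_num at hr)
  have hg0 : 0 < g := Nat.pos_of_ne_zero (by rintro rfl; norm_num at hg)
  obtain ⟨K, hK⟩ : ∃ K, K = (boxOffsets r).card := ⟨_, rfl⟩
  have hK0 : 0 < K := by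
    rw [hK, card_boxOffsets]
    positivity
  obtain ⟨R, hR⟩ : ∃ R, r ^ 2 < R := ⟨_, Nat.lt_succ_self _⟩
  obtain ⟨D, hD⟩ : ∃ D, 2 * R + r < D := ⟨_, Nat.lt_succ_self _⟩
  have hrR : r ≤ R := (Nat.le_self_pow two_ne_zero r).trans hR.le
  obtain ⟨h, hh, c, hc, herr⟩ := exists_eventually_error_le (d := (discPoints R).card) (D := D)
    hα hK0 hg0
  refine ⟨1 - Real.exp (-c), by simpa using hc, by simpa using Real.exp_pos (-c), fun ε hε => ?_⟩
  refine Set.infinite_of_forall_exists_gt fun k₀ => ?_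
  obtain ⟨q, ⟨J, hJ, hp⟩, hq⟩ := ((herr ε hε).and (eventually_gt_atTop k₀)).exists
  have hq0 : 0 < q := by omega
  have hqk : q ≤ g * q * K :=
    (Nat.le_mul_of_pos_left q hg0).trans (Nat.le_mul_of_pos_right _ hK0)
  obtain ⟨hp₁, hη⟩ := hp _ rfl
  refine ⟨g * q * K, ⟨by omega, fun N => ?_⟩, by omega⟩
  have hDM : D ≤ h * D := Nat.le_mul_of_pos_left D hh
  have hM : 0 < h * D := by omega
  obtain ⟨L, hL⟩ : ∃ L, L = J * (h * D) * (N + 1) := ⟨_, rfl⟩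
  have hJL : J * (h * D) ≤ L := hL ▸ Nat.le_mul_of_pos_right _ N.succ_pos
  have hML : h * D ≤ L := (Nat.le_mul_of_pos_left _ hJ).trans hJL
  have hNL : N + 1 ≤ L := hL ▸ Nat.le_mul_of_pos_left _ (Nat.mul_pos hJ hM)
  have hm0 : 0 < g * q := Nat.mul_pos hg0 hq0
  have hn : L ≤ L * (h * D) * (g * q) :=
    (Nat.le_mul_of_pos_right _ hM).trans (Nat.le_mul_of_pos_right _ hm0)
  obtain ⟨T, _, φ, π, G, hφ, hsurj, hcl, hG, hcard⟩ := exists_blowUp (r := r) (L := L)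
    (M := h * D) (m := g * q) (by omega) (by omega)
  have hreg := isRegularOfDegree_blowUp hG hcl
  rw [hcard, ← hK] at hreg
  refine ⟨L * (h * D) * (g * q), by omega, G, by convert hreg, ?_⟩
  have hKq : (K : ℝ) * q ≤ α * (g * q * K : ℕ) / 4 := by
    have : (0 : ℝ) ≤ K * q := by positivity
    push_cast
    nlinarith
  have hk0 : (0 : ℝ) < (g * q * K : ℕ) := by exact_mod_cast hq0.trans_le hqk
  have hover : ∀ t, unifProb G.edgeSet.toFinset (Overloaded π
      ((boxOffsets r).image φ) α
      ((g * q * K : ℕ) / 4 + 3 / 4 * α * (g * q * K : ℕ)) q t) ≤ _ :=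
    fun t => unifProb_overloaded_le hG hcl hα (by rw [hcard, ← hK]; push_cast; rfl)
  rw [hcard, ← hK] at hover
  have hcore := unifProb_mem_core_le (h := h) (D := D) (J := J) (R := R) (q := q)
    (θ₀ := (g * q * K : ℕ) / 4 + α * (g * q * K : ℕ)) hreg hcl hG hcard hφ
    hsurj hover (by rw [← hK]; linarith)
    (by rw [← hK]; linarith [mul_pos hα hk0]) hq0 hr hR hD hh hJ hJL hp₁
  rw [← hK] at hcore
  have := one_sub_le_subgraphProb_half (pow_pos (Real.exp_pos (-c)) _) hη hcore
    (by rw [Fintype.card_fin]; omega)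
  simpa only [sub_sub_cancel, Fintype.card_fin] using this

end Conclusion

/-- For every `α > 0` there are `β, C > 0` such that for every `ε > 0` there are infinitely
many `k` for which there exist arbitrarily large `k`-regular graphs `G` such that, with
probability at least `1 - ε`, every induced subgraph of `G_{1/2}` (induced on a vertex set `s`)
with minimum degree at least `k/4 + αk` has at most `C (1 - β)^{k²} n` vertices. -/
theorem small_core_above_quarter (α : ℝ) (hα : 0 < α) :
    ∃ β : ℝ, 0 < β ∧ ∃ C : ℝ, 0 < C ∧ ∀ ε : ℝ, 0 < ε →
      {k : ℕ | 0 < k ∧ ∀ N : ℕ, ∃ n : ℕ, N ≤ n ∧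
        ∃ G : SimpleGraph (Fin n), G.IsRegularOfDegree k ∧
          1 - ε ≤ subgraphProb G (1/2)
            (fun G' => ∀ s : Finset (Fin n),
              (∀ v ∈ s, (k : ℝ) / 4 + α * k ≤ ((s.filter (fun u => G'.Adj v u)).card : ℝ)) →
              (s.card : ℝ) ≤ C * (1 - β) ^ (k ^ 2) * n)}.Infinite := by
  obtain ⟨β, hβ, -, h⟩ := small_core_above_quarter_of_lt_one α hα
  exact ⟨β, hβ, 1, one_pos, by simpa only [one_mul] using h⟩
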